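/- arXiv:0809.2872 — 3 statements merged into one kernel-verified Lean document; each statement's English description precedes it below -/
import Mathlib

section
/- Let l be a positive integer and let F(t_1, t_2, ..., t_l)(·) be a family of ℝ^p-valued functions defined in a neighborhood of a point x₀ ∈ ℝ^p, depending on l scalar parameters t_1,...,t_l ranging in a neighborhood of 0, such that F(t_1,...,t_l)(x) = x whenever at least one t_j equals 0, the map (t_1,...,t_l,x) ↦ F(t_1,...,t_l)(x) is C^{l-1} in a neighborhood of (0,...,0,x), and it is l times differentiable at (0,...,0,x). Then F(t_1,...,t_l)(x) = x + t_1 t_2 ··· t_l · (∂^l F/∂t_1 ∂t_2 ··· ∂t_l)(0,...,0)(x) + o(t_1 t_2 ··· t_l) as (t_1,...,t_l) → 0. -/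
open MeasureTheory Set Topology

noncomputable section

/-- Euclidean space `ℝ^p`. -/
abbrev E (p : ℕ) : Type := EuclideanSpace ℝ (Fin p)

instance (p : ℕ) : Nonempty (E p) := ⟨0⟩

section Core

variable {V : Type*} [NormedAddCommGroup V] [NormedSpace ℝ V]

/-- Commutator of two vector fields: `[X,Y] = (DY)·X - (DX)·Y`. -/
def vComm (X Y : V → V) : V → V :=
  fun x => fderiv ℝ Y x (X x) - fderiv ℝ X x (Y x)

/-- Left-iterated commutator `[X_{f 0},[X_{f 1},…,[X_{f (k-1)}, X_{f k}]…]]`. -/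
def iterComm {ι : Type*} (X : ι → V → V) : (k : ℕ) → (Fin (k + 1) → ι) → V → V
  | 0, f => X (f 0)
  | k + 1, f => vComm (X (f 0)) (iterComm X k (fun j => f j.succ))

/-- Multiindices of length between `1` and `r` with entries in `ι`. -/
def MIdx (ι : Type*) (r : ℕ) : Type _ := Σ k : Fin r, (Fin (k.1 + 1) → ι)

instance (ι : Type*) [Fintype ι] (r : ℕ) : Fintype (MIdx ι r) := by
  unfold MIdx; infer_instance

/-- Weight `|I|` of a multiindex relative to a weight function `w`. -/
def wtOf {ι : Type*} (w : ι → ℕ) {r : ℕ} (I : MIdx ι r) : ℕ := ∑ j, w (I.2 j)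

/-- The iterated commutator `X_{[I]}` of a multiindex `I`. -/
def commOf {ι : Type*} (X : ι → V → V) {r : ℕ} (I : MIdx ι r) : V → V :=
  iterComm X I.1.1 I.2

/-- Standard weights: `X_0` has weight `2`, all the other fields weight `1`. -/
def wgt {n : ℕ} : Fin (n + 1) → ℕ := fun i => if i = 0 then 2 else 1

/-- Hörmander's condition of weighted step `r` on the set `S`: the commutators
`X_{[I]}` with `|I| ≤ r` span the whole space at every point of `S`. -/
def HormSpan {ι : Type*} (X : ι → V → V) (w : ι → ℕ) (r : ℕ) (S : Set V) : Prop :=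
  ∀ x ∈ S, Submodule.span ℝ {v : V | ∃ I : MIdx ι r, wtOf w I ≤ r ∧ v = commOf X I x} = ⊤

end Core

section Dist

variable {V : Type*} [NormedAddCommGroup V] [NormedSpace ℝ V] [CompleteSpace V]

/-- `φ` is an admissible curve of class `C(δ)` (for the subelliptic distance `d`)
inside `S`, joining `x` to `y`: it is an (absolutely continuous) integral of
`∑_{|I| ≤ r} a_I(t) (X_{[I]})_{φ(t)}` with `|a_I| ≤ δ^{|I|}`. -/
def IsAdmissible {ι : Type*} [Fintype ι] {r : ℕ} (X : ι → V → V) (w : ι → ℕ)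
    (S : Set V) (δ : ℝ) (x y : V) (φ : ℝ → V) : Prop :=
  ∃ a : MIdx ι r → ℝ → ℝ,
    (∀ t ∈ Icc (0:ℝ) 1, φ t ∈ S) ∧ φ 0 = x ∧ φ 1 = y ∧
    (∀ I, Measurable (a I)) ∧
    (∀ I, ∀ t ∈ Icc (0:ℝ) 1, |a I t| ≤ δ ^ wtOf w I) ∧
    (∀ I : MIdx ι r, r < wtOf w I → ∀ t, a I t = 0) ∧
    ∀ t ∈ Icc (0:ℝ) 1,
      φ t = x + ∫ s in (0:ℝ)..t, ∑ I : MIdx ι r, a I s • commOf X I (φ s)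

/-- The subelliptic (Nagel–Stein–Wainger) distance `d` attached to the system `X`. -/
def dCC {ι : Type*} [Fintype ι] (X : ι → V → V) (w : ι → ℕ) (r : ℕ)
    (S : Set V) (x y : V) : ℝ :=
  sInf {δ : ℝ | 0 < δ ∧ ∃ φ : ℝ → V, IsAdmissible (r := r) X w S δ x y φ}

/-- Metric ball of the subelliptic distance `d`. -/
def BCC {ι : Type*} [Fintype ι] (X : ι → V → V) (w : ι → ℕ) (r : ℕ)
    (S : Set V) (x : V) (ρ : ℝ) : Set V :=
  {y | dCC X w r S x y < ρ}

/-- `φ` is an admissible curve of class `C_1(δ)` (for the control distance `d_1`)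
inside `S`, joining `x` to `y`: `φ' = ∑_i a_i(t) (X_i)_{φ(t)}` with `|a_i| ≤ δ^{p_i}`. -/
def IsCtrlAdmissible {ι : Type*} [Fintype ι] (X : ι → V → V) (w : ι → ℕ)
    (S : Set V) (δ : ℝ) (x y : V) (φ : ℝ → V) : Prop :=
  ∃ a : ι → ℝ → ℝ,
    (∀ t ∈ Icc (0:ℝ) 1, φ t ∈ S) ∧ φ 0 = x ∧ φ 1 = y ∧
    (∀ i, Measurable (a i)) ∧
    (∀ i, ∀ t ∈ Icc (0:ℝ) 1, |a i t| ≤ δ ^ w i) ∧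
    ∀ t ∈ Icc (0:ℝ) 1,
      φ t = x + ∫ s in (0:ℝ)..t, ∑ i, a i s • X i (φ s)

/-- The control distance `d_1` attached to the system `X`. -/
def dCtrl {ι : Type*} [Fintype ι] (X : ι → V → V) (w : ι → ℕ)
    (S : Set V) (x y : V) : ℝ :=
  sInf {δ : ℝ | 0 < δ ∧ ∃ φ : ℝ → V, IsCtrlAdmissible X w S δ x y φ}

/-- Metric ball of the control distance `d_1`. -/
def BCtrl {ι : Type*} [Fintype ι] (X : ι → V → V) (w : ι → ℕ)
    (S : Set V) (x : V) (ρ : ℝ) : Set V :=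
  {y | dCtrl X w S x y < ρ}

/-- `x` and `y` are joined, within `W`, by a curve composed of a finite number of
arcs of integral curves of the vector fields `X_i`. -/
def IsIntegralArcChain {ι : Type*} (X : ι → V → V) (W : Set V) (x y : V) : Prop :=
  ∃ N : ℕ, ∃ z : Fin (N + 1) → V, z 0 = x ∧ z (Fin.last N) = y ∧
    ∀ j : Fin N, ∃ (i : ι) (c : ℝ) (γ : ℝ → V),
      γ 0 = z j.castSucc ∧ γ 1 = z j.succ ∧ (∀ t ∈ Icc (0:ℝ) 1, γ t ∈ W) ∧
      ∀ t ∈ Icc (0:ℝ) 1, HasDerivAt γ (c • X i (γ t)) t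

end Dist

/-- The Taylor-polynomial vector field of degree `m` centered at `x₀` which
approximates `Xi` (derivatives taken within `S`). -/
def taylorVF {p : ℕ} (Xi : E p → E p) (S : Set (E p)) (m : ℕ) (x₀ : E p) : E p → E p :=
  fun x => ∑ k ∈ Finset.range (m + 1),
    (k.factorial : ℝ)⁻¹ • iteratedFDerivWithin ℝ k Xi S x₀ (fun _ => x - x₀)

section Exp

variable {V : Type*} [NormedAddCommGroup V] [NormedSpace ℝ V] [CompleteSpace V]

open scoped Classical in
/-- `expVF X x = exp(X)(x)`: the time-one value of an integral curve of `X`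
issued from `x` (chosen by choice; under Lipschitz assumptions this is the
unique flow). -/
def expVF (X : V → V) (x : V) : V :=
  if h : ∃ φ : ℝ → V, φ 0 = x ∧ ∀ t ∈ Icc (0:ℝ) 1, φ t = x + ∫ s in (0:ℝ)..t, X (φ s)
  then h.choose 1 else x

/-- The maps `𝒞_l(t_1,…,t_l)` built from exponentials of the fields
`X_{f 0},…,X_{f k}` with independent parameters `t_0,…,t_k`. -/
def mqExp {ι : Type*} (X : ι → V → V) :
    (k : ℕ) → (Fin (k + 1) → ι) → (Fin (k + 1) → ℝ) → V → V
  | 0, f, t => expVF (fun y => t 0 • X (f 0) y)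
  | k + 1, f, t => fun x =>
      haveI : Nonempty V := ⟨0⟩
      Function.invFun (mqExp X k (fun j => f j.succ) (fun j => t j.succ))
        (expVF (fun y => (-(t 0)) • X (f 0) y)
          (mqExp X k (fun j => f j.succ) (fun j => t j.succ)
            (expVF (fun y => t 0 • X (f 0) y) x)))

/-- The iterated mixed derivative `∂^l G/∂t_1⋯∂t_l` at the origin. -/
def mixedDeriv : (l : ℕ) → ((Fin l → ℝ) → V → V) → V → V
  | 0, G => G (fun i => i.elim0)
  | l + 1, G => mixedDeriv l (fun t x => deriv (fun s : ℝ => G (Fin.cons s t) x) 0)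

/-- The quasiexponential map `C_{ℓ(I)}(t, X_I)`. -/
def qExpOf {ι : Type*} (X : ι → V → V) (w : ι → ℕ) (t : ℝ) {r : ℕ} (I : MIdx ι r) : V → V :=
  mqExp X I.1.1 I.2 (fun j => t ^ w (I.2 j))

/-- The map `E_I(t)`. -/
def Emap {ι : Type*} (X : ι → V → V) (w : ι → ℕ) {r : ℕ} (I : MIdx ι r)
    (t : ℝ) : V → V :=
  haveI : Nonempty V := ⟨0⟩
  if 0 ≤ t then qExpOf X w (Real.rpow t ((wtOf w I : ℝ))⁻¹) I
  else Function.invFun (qExpOf X w (Real.rpow |t| ((wtOf w I : ℝ))⁻¹) I)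

end Exp

/-- The map `E_η^X(x,h) = E_{I_1}(h_1) E_{I_2}(h_2) ⋯ E_{I_p}(h_p)(x)`. -/
def EmapFam {p : ℕ} {ι : Type*} {r : ℕ} (X : ι → E p → E p) (w : ι → ℕ)
    (η : Fin p → MIdx ι r) (x : E p) (h : Fin p → ℝ) : E p :=
  (List.ofFn fun j : Fin p => Emap X w (η j) (h j)).foldr (fun f y => f y) x

/-- `λ_η(x)`: the determinant of the `p × p` matrix whose rows are the
commutators `(X_{[I_j]})_x`, `I_j ∈ η`. -/
def lamDet {p : ℕ} {ι : Type*} {r : ℕ} (X : ι → E p → E p) (η : Fin p → MIdx ι r)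
    (x : E p) : ℝ :=
  Matrix.det (Matrix.of fun j k => commOf X (η j) x k)

/-- The differential operator `X_i` acting on a scalar function. -/
def Xop {p : ℕ} (Xi : E p → E p) (f : E p → ℝ) (y : E p) : ℝ := fderiv ℝ f y (Xi y)

/-- `|Xf(y)| = (∑_i |X_i f(y)|²)^{1/2}`. -/
def gradLen {p n : ℕ} (X : Fin n → E p → E p) (f : E p → ℝ) (y : E p) : ℝ :=
  Real.sqrt (∑ i, (Xop (X i) f y) ^ 2)

/-- The formal adjoint `X_i^*` acting on a scalar function:
`X_i^* f = -∑_j ∂_{y_j} (b_{ij} f)`. -/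
def XstarOp {p : ℕ} (Xi : E p → E p) (f : E p → ℝ) (y : E p) : ℝ :=
  - ∑ j, fderiv ℝ (fun z => Xi z j * f z) y (EuclideanSpace.single j 1)

section Free

/-- Left-iterated bracket in the free Lie algebra on `n` generators. -/
def freeBracket {n : ℕ} : (k : ℕ) → (Fin (k + 1) → Fin n) → FreeLieAlgebra ℝ (Fin n)
  | 0, f => FreeLieAlgebra.of ℝ (f 0)
  | k + 1, f => ⁅FreeLieAlgebra.of ℝ (f 0), freeBracket k (fun j => f j.succ)⁆

/-- The free bracket associated to a multiindex. -/
def freeBracketOf {n r : ℕ} (I : MIdx (Fin n) r) : FreeLieAlgebra ℝ (Fin n) :=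
  freeBracket I.1.1 I.2

/-- Submodule of the free Lie algebra spanned by left-iterated brackets of
length `> r`. -/
def longBrackets (n r : ℕ) : Submodule ℝ (FreeLieAlgebra ℝ (Fin n)) :=
  Submodule.span ℝ {z | ∃ k : ℕ, r ≤ k ∧ ∃ f : Fin (k + 1) → Fin n, z = freeBracket k f}

/-- The system `X` is free up to step `r` on `S`: every linear relation among
the iterated commutators of length `≤ r` at a point of `S` follows from
anticommutativity and the Jacobi identity (i.e. it already holds in the free
nilpotent Lie algebra of step `r`). -/
def FreeUpTo {V : Type*} [NormedAddCommGroup V] [NormedSpace ℝ V] {n : ℕ}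
    (X : Fin n → V → V) (r : ℕ) (S : Set V) : Prop :=
  ∀ x ∈ S, ∀ c : MIdx (Fin n) r → ℝ,
    (∑ I, c I • commOf X I x) = 0 →
    (∑ I, c I • freeBracketOf I) ∈ longBrackets n r

end Free

section MultiparameterExpansion

open Filter

variable {ι W : Type*} [NormedAddCommGroup W] [NormedSpace ℝ W]

/-- A function vanishing on the hyperplane `t i = 0` has vanishing derivatives along it. -/
lemma lineDeriv_eq_zero_of_vanish {Ψ : (ι → ℝ) → W} {i : ι} (hΨ : ∀ t, t i = 0 → Ψ t = 0)
    {t v : ι → ℝ} (ht : t i = 0) (hv : v i = 0) : lineDeriv ℝ Ψ t v = 0 := by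
  have : (fun s : ℝ => Ψ (t + s • v)) = fun _ => 0 := by
    ext s
    exact hΨ _ (by simp [ht, hv])
  simp [lineDeriv, this]

section

variable [Fintype ι]

/-- All iterated directional derivatives of `Ψ` of order less than `n` are differentiable
near `0`, and those of order `n` are differentiable at `0`. -/
def IterLineDifferentiable : ℕ → ((ι → ℝ) → W) → Prop
  | 0, Ψ => DifferentiableAt ℝ Ψ 0
  | n + 1, Ψ => (∀ᶠ t in 𝓝 0, DifferentiableAt ℝ Ψ t) ∧
      ∀ v, IterLineDifferentiable n (fun t => lineDeriv ℝ Ψ t v)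

lemma iterLineDifferentiable_slice {Y : Type*} [NormedAddCommGroup Y] [NormedSpace ℝ Y]
    (n : ℕ) (f : (ι → ℝ) × Y → W) (x : Y) (w : W)
    (hf : ContDiffAt ℝ n f (0, x)) (hd : DifferentiableAt ℝ (iteratedFDeriv ℝ n f) (0, x)) :
    IterLineDifferentiable n (fun t => f (t, x) - w) := by
  have hslice : ∀ (f : (ι → ℝ) × Y → W) (w : W) (t : ι → ℝ), DifferentiableAt ℝ f (t, x) →
      DifferentiableAt ℝ (fun t => f (t, x) - w) t := fun f w t ht =>
    (DifferentiableAt.comp (f := fun t : ι → ℝ => (t, x)) t ht (by fun_prop)).sub_const w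
  induction n generalizing f w with
  | zero =>
    refine hslice f w 0 ?_
    rw [iteratedFDeriv_zero_eq_comp] at hd
    exact ((continuousMultilinearCurryFin0 ℝ ((ι → ℝ) × Y) W).symm.comp_differentiableAt_iff).1 hd
  | succ n ih =>
    have hev : ∀ᶠ q in 𝓝 ((0 : ι → ℝ), x), DifferentiableAt ℝ f q := by
      filter_upwards [hf.eventually (by simp)] with q hq
      exact hq.differentiableAt (by simp)
    have hcont : Tendsto (fun t : ι → ℝ => (t, x)) (𝓝 0) (𝓝 (0, x)) :=
      (by fun_prop : Continuous fun t : ι → ℝ => (t, x)).tendsto 0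
    refine ⟨(hcont.eventually hev).mono (hslice f w), fun v => ?_⟩
    let L : (((ι → ℝ) × Y) →L[ℝ] W) →L[ℝ] W := ContinuousLinearMap.apply ℝ W (v, 0)
    have hline : (fun t => lineDeriv ℝ (fun t => f (t, x) - w) t v) =
        fun t => lineDeriv ℝ f (t, x) (v, 0) - 0 := by
      ext t
      simp [lineDeriv]
    have heq : (fun q => lineDeriv ℝ f q (v, 0)) =ᶠ[𝓝 (0, x)] L ∘ fderiv ℝ f := by
      filter_upwards [hev] with q hq
      exact hq.lineDeriv_eq_fderiv
    have hfd : ContDiffAt ℝ n (fderiv ℝ f) (0, x) := hf.fderiv_right (by simp)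
    have hd' : DifferentiableAt ℝ (iteratedFDeriv ℝ n (fderiv ℝ f)) (0, x) := by
      rw [funext fun q => iteratedFDeriv_succ_eq_comp_right (𝕜 := ℝ) (f := f) (x := q) (n := n)]
        at hd
      exact (LinearIsometryEquiv.comp_differentiableAt_iff _).1 hd
    have hL : iteratedFDeriv ℝ n (L ∘ fderiv ℝ f) =ᶠ[𝓝 (0, x)]
        fun q => L.compContinuousMultilinearMap (iteratedFDeriv ℝ n (fderiv ℝ f) q) := by
      filter_upwards [hfd.eventually (by simp)] with q hq
      exact L.iteratedFDeriv_comp_left hq le_rfl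
    rw [hline]
    refine ih _ 0 ((L.contDiff.contDiffAt.comp _ hfd).congr_of_eventuallyEq heq) ?_
    refine DifferentiableAt.congr_of_eventuallyEq ?_ ((heq.iteratedFDeriv ℝ n).trans hL)
    exact (ContinuousLinearMap.compContinuousMultilinearMapL ℝ
      (fun _ : Fin n => (ι → ℝ) × Y) (((ι → ℝ) × Y) →L[ℝ] W) W L).differentiableAt.comp _ hd'

end

variable [DecidableEq ι]

/-- Iterated partial derivative of `Ψ`, first in the coordinate `c 0`, then in `c 1`, and so on. -/
def iterPartial : (n : ℕ) → (Fin n → ι) → ((ι → ℝ) → W) → (ι → ℝ) → W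
  | 0, _, Ψ => Ψ
  | n + 1, c, Ψ =>
      iterPartial n (fun i => c i.succ) (fun t => lineDeriv ℝ Ψ t (Pi.single (c 0) 1))

lemma lineDeriv_iterPartial_last (n : ℕ) (c : Fin (n + 1) → ι) (Ψ : (ι → ℝ) → W) (a : ι → ℝ) :
    lineDeriv ℝ (iterPartial n (fun i => c i.castSucc) Ψ) a (Pi.single (c (Fin.last n)) 1) =
      iterPartial (n + 1) c Ψ a := by
  induction n generalizing Ψ with
  | zero => rfl
  | succ n ih => exact ih (fun i => c i.succ) _

lemma iterPartial_succ_sub_const (n : ℕ) (c : Fin (n + 1) → ι) (Ψ : (ι → ℝ) → W) (w : W) :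
    iterPartial (n + 1) c (fun t => Ψ t - w) = iterPartial (n + 1) c Ψ := by
  simp only [iterPartial, lineDeriv, deriv_sub_const]

lemma mixedDeriv_eq_iterPartial {V : Type*} [NormedAddCommGroup V] [NormedSpace ℝ V]
    [CompleteSpace V] (n : ℕ) (c : Fin n → ι) (G : (Fin n → ℝ) → V → V) (x : V)
    (Ψ : (ι → ℝ) → V) (a : ι → ℝ)
    (hG : ∀ t, G t x = Ψ (a + ∑ i, t i • Pi.single (c i) (1 : ℝ))) :
    mixedDeriv n G x = iterPartial n c Ψ a := by
  induction n generalizing Ψ with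
  | zero => simp [mixedDeriv, iterPartial, hG]
  | succ n ih =>
    refine ih (fun i => c i.succ) _ _ fun t => ?_
    simp only [hG, lineDeriv, Fin.sum_univ_succ, Fin.cons_zero, Fin.cons_succ]
    congr 1
    ext s
    congr 1
    abel

variable [Fintype ι]

lemma norm_update_le {t : ι → ℝ} {i : ι} {s : ℝ} (hs : |s| ≤ |t i|) :
    ‖Function.update t i s‖ ≤ ‖t‖ := by
  refine (pi_norm_le_iff_of_nonneg (norm_nonneg t)).2 fun k => ?_
  rcases eq_or_ne k i with rfl | hk
  · simpa using hs.trans (norm_le_pi_norm t k)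
  · simpa [hk] using norm_le_pi_norm t k

/-- If `Ψ` vanishes whenever one of the coordinates `c 0, …, c (n - 1), j` does, then it equals
its leading monomial up to `o(‖t‖) * ∏ |t (c i)|`. -/
lemma eventually_norm_sub_monomial_le (n : ℕ) (c : Fin n → ι) (hc : Function.Injective c)
    (j : ι) (hj : ∀ i, c i ≠ j) (Ψ : (ι → ℝ) → W) (hreg : IterLineDifferentiable n Ψ)
    (hvc : ∀ i t, t (c i) = 0 → Ψ t = 0) (hvj : ∀ t, t j = 0 → Ψ t = 0)
    {ε : ℝ} (hε : 0 < ε) :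
    ∀ᶠ t in 𝓝 (0 : ι → ℝ),
      ‖Ψ t - ((∏ i, t (c i)) * t j) • lineDeriv ℝ (iterPartial n c Ψ) 0 (Pi.single j 1)‖ ≤
        ε * ‖t‖ * ∏ i, |t (c i)| := by
  induction n generalizing Ψ with
  | zero =>
    have hd : DifferentiableAt ℝ Ψ 0 := hreg
    filter_upwards [hd.hasFDerivAt.isLittleO.def hε] with t ht
    have hker : fderiv ℝ Ψ 0 (t - t j • Pi.single j 1) = 0 := by
      rw [← hd.lineDeriv_eq_fderiv]
      exact lineDeriv_eq_zero_of_vanish hvj rfl (by simp)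
    rw [map_sub, map_smul, sub_eq_zero] at hker
    simpa [iterPartial, hd.lineDeriv_eq_fderiv, hvj 0 rfl, hker] using ht
  | succ n ih =>
    obtain ⟨hdiff, hnext⟩ := hreg
    have hIH := ih (fun i => c i.succ) (fun a b h => by simpa using hc h) (fun i => hj i.succ)
      (fun t => lineDeriv ℝ Ψ t (Pi.single (c 0) 1)) (hnext _)
      (fun i t ht => lineDeriv_eq_zero_of_vanish (hvc i.succ) ht
        (Pi.single_eq_of_ne (hc.ne (Fin.succ_ne_zero i)) _))
      (fun t ht => lineDeriv_eq_zero_of_vanish hvj ht (Pi.single_eq_of_ne (hj 0).symm _))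
    obtain ⟨δ, hδ, hball⟩ := Metric.eventually_nhds_iff.1 (hdiff.and hIH)
    refine Metric.eventually_nhds_iff.2 ⟨δ, hδ, fun t ht => ?_⟩
    rw [dist_zero_right] at ht
    simp only [iterPartial]
    set m := lineDeriv ℝ (iterPartial n (fun i => c i.succ)
      (fun t => lineDeriv ℝ Ψ t (Pi.single (c 0) 1))) 0 (Pi.single j 1)
    set w := ((∏ i : Fin n, t (c i.succ)) * t j) • m
    let u : ℝ → ι → ℝ := Function.update t (c 0)
    have hu_succ : ∀ s (i : Fin n), u s (c i.succ) = t (c i.succ) := fun s i =>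
      Function.update_of_ne (hc.ne (Fin.succ_ne_zero i)) _ _
    have hu_j : ∀ s, u s j = t j := fun s => Function.update_of_ne (hj 0).symm _ _
    have hmem : ∀ s ∈ Metric.closedBall (0 : ℝ) |t (c 0)|, ‖u s‖ ≤ ‖t‖ := fun s hs =>
      norm_update_le (by simpa using hs)
    have hmvt := (convex_closedBall (0 : ℝ) |t (c 0)|).norm_image_sub_le_of_norm_hasDerivWithin_le
      (f := fun s => Ψ (u s) - s • w)
      (f' := fun s => lineDeriv ℝ Ψ (u s) (Pi.single (c 0) 1) - w)
      (C := ε * ‖t‖ * ∏ i : Fin n, |t (c i.succ)|) (x := 0) (y := t (c 0))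
      (fun s hs => by
        have hdu : DifferentiableAt ℝ Ψ (u s) :=
          (hball (by simpa using (hmem s hs).trans_lt ht)).1
        rw [hdu.lineDeriv_eq_fderiv]
        have h1 := hdu.hasFDerivAt.comp_hasDerivAt s (hasDerivAt_update t (c 0) s)
        have h2 := (hasDerivAt_id s).smul_const w
        rw [one_smul] at h2
        exact (h1.sub h2).hasDerivWithinAt)
      (fun s hs => by
        have h := (hball (by simpa using (hmem s hs).trans_lt ht)).2
        simp only [hu_succ, hu_j] at h
        refine h.trans ?_
        gcongr
        exact hmem s hs)
      (by simp) (by simp)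
    have hu0 : Ψ (u 0) = 0 := hvc 0 _ (by simp [u])
    have hut : u (t (c 0)) = t := Function.update_eq_self _ _
    simp only [hu0, hut, zero_smul, sub_zero, Real.norm_eq_abs] at hmvt
    rw [Fin.prod_univ_succ, Fin.prod_univ_succ, mul_assoc (t (c 0)), mul_smul]
    exact hmvt.trans_eq (by ring)

/-- A function of `n + 1` real variables vanishing on all coordinate hyperplanes is equivalent to
its leading monomial at the origin. -/
lemma eventually_norm_sub_prod_smul_le (n : ℕ) (Ψ : (Fin (n + 1) → ℝ) → W)
    (hreg : IterLineDifferentiable n Ψ) (hv : ∀ i t, t i = 0 → Ψ t = 0) {ε : ℝ} (hε : 0 < ε) :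
    ∀ᶠ t in 𝓝 (0 : Fin (n + 1) → ℝ),
      ‖Ψ t - (∏ i, t i) • iterPartial (n + 1) id Ψ 0‖ ≤ ε * |∏ i, t i| := by
  let m : Fin (n + 1) → W := fun j =>
    lineDeriv ℝ (iterPartial n j.succAbove Ψ) 0 (Pi.single j 1)
  have hmax : ∀ η > (0 : ℝ), ∀ j, ∀ᶠ t in 𝓝 (0 : Fin (n + 1) → ℝ), ‖t‖ = |t j| →
      ‖Ψ t - (∏ i, t i) • m j‖ ≤ η * |∏ i, t i| := by
    intro η hη j
    filter_upwards [eventually_norm_sub_monomial_le n j.succAbove Fin.succAbove_right_injective j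
      (fun i => Fin.succAbove_ne j i) Ψ hreg (fun i => hv _) (hv j) hη] with t ht hnorm
    rw [Fin.prod_univ_succAbove _ j, mul_comm (t j), abs_mul, Finset.abs_prod]
    exact ht.trans_eq (by rw [hnorm]; ring)
  have hm : ∀ j, m j = iterPartial (n + 1) id Ψ 0 := by
    intro j
    rw [← lineDeriv_iterPartial_last n id Ψ 0]
    have hlast : m (Fin.last n) = lineDeriv ℝ (iterPartial n (fun i => id i.castSucc) Ψ) 0
        (Pi.single (id (Fin.last n)) 1) := by
      simp only [m, Fin.succAbove_last]
      rfl
    rw [← hlast]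
    refine eq_of_forall_dist_le fun η hη => ?_
    have hdiag : Tendsto (fun s : ℝ => (fun _ : Fin (n + 1) => s)) (𝓝[≠] 0) (𝓝 0) :=
      ((by fun_prop : Continuous fun s : ℝ => (fun _ : Fin (n + 1) => s)).tendsto 0).mono_left
        nhdsWithin_le_nhds
    obtain ⟨s, ⟨h1, h2⟩, hs⟩ := ((hdiag.eventually ((hmax (η / 2) (half_pos hη) j).and
      (hmax (η / 2) (half_pos hη) (Fin.last n)))).and self_mem_nhdsWithin).exists
    have hnorm : ‖(fun _ : Fin (n + 1) => s)‖ = |s| := by simp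
    have hpos : 0 < |∏ _i : Fin (n + 1), s| := by
      rw [abs_pos]
      exact Finset.prod_ne_zero_iff.2 fun _ _ => hs
    have h := dist_triangle_left ((∏ _i : Fin (n + 1), s) • m j)
      ((∏ _i : Fin (n + 1), s) • m (Fin.last n)) (Ψ fun _ => s)
    rw [dist_smul₀, dist_eq_norm (Ψ _), dist_eq_norm (Ψ _), Real.norm_eq_abs] at h
    have h3 := h.trans (add_le_add (h1 hnorm) (h2 hnorm))
    rw [← add_mul, add_halves, mul_comm] at h3
    exact le_of_mul_le_mul_right h3 hpos
  filter_upwards [eventually_all.2 (hmax ε hε)] with t ht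
  obtain ⟨j, hj⟩ := Finite.exists_max fun i => |t i|
  rw [← hm j]
  exact ht j (le_antisymm ((pi_norm_le_iff_of_nonneg (abs_nonneg _)).2 hj) (norm_le_pi_norm t j))

end MultiparameterExpansion

/-- Abstract expansion of multiparameter families of maps.
If `F(t₁,…,t_l)(x) = x` whenever some `t_j = 0`, `F` is `C^{l-1}` near
`(0,…,0,x)` and `l` times differentiable at `(0,…,0,x)`, then
`F(t₁,…,t_l)(x) = x + t₁⋯t_l ∂^l F/∂t₁⋯∂t_l(0,…,0)(x) + o(t₁⋯t_l)`. -/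
theorem abstract_multiparameter_expansion
    (p l : ℕ) (hl : 1 ≤ l)
    (U : Set (E p)) (hU : IsOpen U)
    (F : (Fin l → ℝ) → E p → E p)
    (hid : ∀ t : Fin l → ℝ, (∃ j, t j = 0) → ∀ y ∈ U, F t y = y)
    (hreg : ∀ x ∈ U, ContDiffAt ℝ (l - 1 : ℕ)
      (fun q : (Fin l → ℝ) × E p => F q.1 q.2) ((0 : Fin l → ℝ), x))
    (hdiff : ∀ x ∈ U, DifferentiableAt ℝ
      (iteratedFDeriv ℝ (l - 1) (fun q : (Fin l → ℝ) × E p => F q.1 q.2))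
      ((0 : Fin l → ℝ), x)) :
    ∀ x ∈ U, ∀ ε > (0:ℝ), ∃ δ > (0:ℝ), ∀ t : Fin l → ℝ, (∀ j, |t j| < δ) →
      ‖F t x - x - (∏ j, t j) • mixedDeriv l F x‖ ≤ ε * |∏ j, t j| := by
  obtain ⟨n, rfl⟩ := Nat.exists_eq_add_of_le' hl
  intro x hx ε hε
  have hreg' : IterLineDifferentiable n (fun t => F t x - x) :=
    iterLineDifferentiable_slice n (fun q : (Fin (n + 1) → ℝ) × E p => F q.1 q.2) x x
      (hreg x hx) (hdiff x hx)
  obtain ⟨δ, hδ, h⟩ := Metric.eventually_nhds_iff.1 <|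
    eventually_norm_sub_prod_smul_le n (fun t => F t x - x) hreg'
      (fun i t ht => by rw [hid t ⟨i, ht⟩ x hx, sub_self]) hε
  refine ⟨δ, hδ, fun t ht => ?_⟩
  rw [mixedDeriv_eq_iterPartial (n + 1) id F x (fun t => F t x) 0, ← iterPartial_succ_sub_const]
  · exact h (by rw [dist_zero_right]; exact (pi_norm_lt_iff hδ).2 ht)
  · intro t
    congr 1
    rw [zero_add]
    exact pi_eq_sum_univ' t

end
end

section
/- Let O be an open subset of ℝ^p, ε > 0, and let A, B : (−ε, ε) × O → ℝ^p be C^1 functions with A(0,x) = x and B(0,x) = x for every x ∈ O; for t sufficiently small A(t,·) and B(t,·) are invertible, with inverses denoted A^{-1}(t,·) and B^{-1}(t,·). Set F(t,s,x) = A^{-1}(t, B^{-1}(s, A(t, B(s,x)))). Assume that for every x ∈ O the maps A and B are twice differentiable at (0,x). Then ∂²F/∂t∂s(0,0,x) = (∂²A/∂x∂t)(0,x) · (∂B/∂s)(0,x) − (∂²B/∂s∂x)(0,x) · (∂A/∂t)(0,x). -/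
open MeasureTheory Set Topology

noncomputable section

section Conjugation

open Filter

variable {V : Type*} [NormedAddCommGroup V] [NormedSpace ℝ V]

/-- The spatial differential of a family of maps at a time where it is locally the identity. -/
theorem fderiv_inr_of_eventually_eq_id {U : ℝ → V → V} {t : ℝ} {x : V}
    (hU : DifferentiableAt ℝ (fun q : ℝ × V => U q.1 q.2) (t, x))
    (hid : ∀ᶠ y in 𝓝 x, U t y = y) (v : V) :
    fderiv ℝ (fun q : ℝ × V => U q.1 q.2) (t, x) (0, v) = v := by
  have hcomp := hU.hasFDerivAt.comp x (hasFDerivAt_prodMk_right t x)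
  have heq := hcomp.unique ((hasFDerivAt_id x).congr_of_eventuallyEq hid)
  simpa using congrArg (fun L => L v) heq

/-- The time derivative of a family of maps in terms of its full differential. -/
theorem hasDerivAt_time {U : ℝ → V → V} {t : ℝ} {x : V}
    (hU : DifferentiableAt ℝ (fun q : ℝ × V => U q.1 q.2) (t, x)) :
    HasDerivAt (fun r => U r x) (fderiv ℝ (fun q : ℝ × V => U q.1 q.2) (t, x) (1, 0)) t :=
  HasFDerivAt.comp_hasDerivAt (f := fun r : ℝ => (r, x)) t hU.hasFDerivAt
    ((hasDerivAt_id t).prodMk (hasDerivAt_const t x))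

/-- The spatial differential of the time derivative is the mixed second derivative. -/
theorem hasFDerivAt_deriv_time {U : ℝ → V → V} {t : ℝ} {x : V}
    (hU : ∀ᶠ q in 𝓝 (t, x), DifferentiableAt ℝ (fun q : ℝ × V => U q.1 q.2) q)
    (hU2 : DifferentiableAt ℝ (fderiv ℝ (fun q : ℝ × V => U q.1 q.2)) (t, x)) :
    HasFDerivAt (fun y => deriv (fun r => U r y) t)
      (((fderiv ℝ (fderiv ℝ (fun q : ℝ × V => U q.1 q.2)) (t, x)).comp
        (ContinuousLinearMap.inr ℝ ℝ V)).flip (1, 0)) x := by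
  have hpath : HasFDerivAt (fun y : V => (t, y)) (ContinuousLinearMap.inr ℝ ℝ V) x :=
    hasFDerivAt_prodMk_right t x
  have hcomp := (hU2.hasFDerivAt.comp x hpath).clm_apply
    (hasFDerivAt_const ((1 : ℝ), (0 : V)) x)
  refine (hcomp.congr_of_eventuallyEq ?_).congr_fderiv (by ext v; simp)
  filter_upwards [hpath.continuousAt.eventually hU] with y hy
  exact (hasDerivAt_time hy).deriv

/-- A local left inverse of a `C¹` family of maps starting at the identity is `C¹`. -/
theorem contDiffAt_of_leftInverse [CompleteSpace V] {U W : ℝ → V → V} {x : V}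
    (hU : ContDiffAt ℝ 1 (fun q : ℝ × V => U q.1 q.2) (0, x))
    (hU0 : ∀ᶠ y in 𝓝 x, U 0 y = y)
    (hW : ∀ᶠ q : ℝ × V in 𝓝 (0, x), W q.1 (U q.1 q.2) = q.2) :
    ContDiffAt ℝ 1 (fun q : ℝ × V => W q.1 q.2) (0, x) := by
  have hdiff := hU.differentiableAt one_ne_zero
  set D := fderiv ℝ (fun q : ℝ × V => U q.1 q.2) (0, x)
  have hDinr : ∀ v, D (0, v) = v := fderiv_inr_of_eventually_eq_id hdiff hU0
  have hDapp : ∀ q : ℝ × V, D q = q.1 • D (1, 0) + q.2 := fun q => by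
    conv_lhs => rw [show q = q.1 • ((1 : ℝ), (0 : V)) + (0, q.2) by ext <;> simp]
    rw [map_add, map_smul, hDinr]
  let e : (ℝ × V) ≃L[ℝ] (ℝ × V) := ContinuousLinearEquiv.equivOfInverse
    ((ContinuousLinearMap.fst ℝ ℝ V).prod D)
    ((ContinuousLinearMap.fst ℝ ℝ V).prod
      (ContinuousLinearMap.snd ℝ ℝ V - (ContinuousLinearMap.fst ℝ ℝ V).smulRight (D (1, 0))))
    (fun q => Prod.ext rfl (by
      change D q - q.1 • D (1, 0) = q.2
      rw [hDapp q, add_sub_cancel_left]))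
    (fun q => Prod.ext rfl (by
      change D (q.1, q.2 - q.1 • D (1, 0)) = q.2
      rw [hDapp, add_sub_cancel]))
  have hΦ : ContDiffAt ℝ 1 (fun q : ℝ × V => (q.1, U q.1 q.2)) (0, x) :=
    contDiffAt_fst.prodMk hU
  have hΦ' : HasFDerivAt (fun q : ℝ × V => (q.1, U q.1 q.2)) (e : (ℝ × V) →L[ℝ] (ℝ × V)) (0, x) :=
    hasFDerivAt_fst.prodMk hdiff.hasFDerivAt
  have hstrict := hΦ.hasStrictFDerivAt' hΦ' one_ne_zero
  have hsmooth := hΦ.to_localInverse hΦ' one_ne_zero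
  have hright := hstrict.eventually_right_inverse
  have htendsto := hstrict.localInverse_tendsto
  simp only [hU0.self_of_nhds] at hsmooth hright htendsto
  refine hsmooth.snd.congr_of_eventuallyEq ?_
  filter_upwards [hright, htendsto.eventually hW] with q hq hWq
  obtain ⟨hq1, hq2⟩ := Prod.ext_iff.1 hq
  simp only at hq1 hq2
  rw [hq2, hq1] at hWq
  exact hWq

/-- Derivative at the origin of a left inverse of a curve of operators issued from `1`. -/
theorem hasDerivAt_of_mul_eq_one {R : Type*} [NormedRing R] [HasSummableGeomSeries R]
    [NormedAlgebra ℝ R] {L M : ℝ → R} {L' : R} {t : ℝ} (hL : HasDerivAt L L' t) (hL1 : L t = 1)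
    (hML : ∀ᶠ s in 𝓝 t, M s * L s = 1) : HasDerivAt M (-L') t := by
  have hinv : HasFDerivAt Ring.inverse
      (-ContinuousLinearMap.mulLeftRight ℝ R ((1 : Rˣ)⁻¹ : Rˣ) ((1 : Rˣ)⁻¹ : Rˣ)) (L t) := by
    rw [hL1]
    exact hasFDerivAt_ringInverse (1 : Rˣ)
  have hcomp := hinv.comp_hasDerivAt t hL
  have hunit : ∀ᶠ s in 𝓝 t, IsUnit (L s) := by
    refine hL.continuousAt.eventually (Units.isOpen.mem_nhds ?_)
    rw [hL1]
    exact isUnit_one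
  refine (hcomp.congr_of_eventuallyEq ?_).congr_deriv (by simp)
  filter_upwards [hunit, hML] with s hs hMs
  calc M s = M s * (L s * Ring.inverse (L s)) := by rw [Ring.mul_inverse_cancel _ hs, mul_one]
    _ = Ring.inverse (L s) := by rw [← mul_assoc, hMs, one_mul]

/-- The mixed derivative of `A⁻¹(t, B⁻¹(s, A(t, B(s, x))))` at the origin, for families of maps
given near `(0, x)`. -/
theorem hasDerivAt_deriv_conjugation [CompleteSpace V] {A B Ainv Binv : ℝ → V → V} {x : V}
    (hA : ContDiffAt ℝ 1 (fun q : ℝ × V => A q.1 q.2) (0, x))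
    (hB : ContDiffAt ℝ 1 (fun q : ℝ × V => B q.1 q.2) (0, x))
    (hA0 : ∀ᶠ y in 𝓝 x, A 0 y = y) (hB0 : ∀ᶠ y in 𝓝 x, B 0 y = y)
    (hA2 : DifferentiableAt ℝ (fderiv ℝ (fun q : ℝ × V => A q.1 q.2)) (0, x))
    (hB2 : DifferentiableAt ℝ (fderiv ℝ (fun q : ℝ × V => B q.1 q.2)) (0, x))
    (hAinv : ∀ᶠ q : ℝ × V in 𝓝 (0, x), Ainv q.1 (A q.1 q.2) = q.2)
    (hBinv : ∀ᶠ q : ℝ × V in 𝓝 (0, x), Binv q.1 (B q.1 q.2) = q.2) :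
    HasDerivAt (fun s : ℝ => deriv (fun t : ℝ => Ainv t (Binv s (A t (B s x)))) 0)
      (fderiv ℝ (fun y => deriv (fun t : ℝ => A t y) 0) x (deriv (fun s : ℝ => B s x) 0)
        - fderiv ℝ (fun y => deriv (fun s : ℝ => B s y) 0) x (deriv (fun t : ℝ => A t x) 0)) 0 := by
  have differentiable_near : ∀ {U : ℝ → V → V},
      ContDiffAt ℝ 1 (fun q : ℝ × V => U q.1 q.2) (0, x) →
      ∀ᶠ q in 𝓝 ((0 : ℝ), x), DifferentiableAt ℝ (fun q : ℝ × V => U q.1 q.2) q := fun hU =>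
    (hU.eventually (by simp)).mono fun _ hq => hq.differentiableAt one_ne_zero
  have hAd := differentiable_near hA
  have hBd := differentiable_near hB
  have hAinvd := (contDiffAt_of_leftInverse hA hA0 hAinv).differentiableAt one_ne_zero
  have hBinvd := differentiable_near (contDiffAt_of_leftInverse hB hB0 hBinv)
  have hline : HasDerivAt (fun s : ℝ => (s, x)) ((1 : ℝ), (0 : V)) 0 :=
    (hasDerivAt_id 0).prodMk (hasDerivAt_const 0 x)
  have hBx := hasDerivAt_time hBd.self_of_nhds
  have hBxtendsto : Tendsto (fun s => B s x) (𝓝 0) (𝓝 x) := by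
    simpa [hB0.self_of_nhds] using hBx.continuousAt.tendsto
  have hgraph : Tendsto (fun s : ℝ => (s, B s x)) (𝓝 0) (𝓝 (0, x)) :=
    tendsto_id.prodMk_nhds hBxtendsto
  have hslice : Tendsto (fun s : ℝ => ((0 : ℝ), B s x)) (𝓝 0) (𝓝 (0, x)) :=
    tendsto_const_nhds.prodMk_nhds hBxtendsto
  set DA := fderiv ℝ (fun q : ℝ × V => A q.1 q.2)
  set DB := fderiv ℝ (fun q : ℝ × V => B q.1 q.2)
  set DAinv := fderiv ℝ (fun q : ℝ × V => Ainv q.1 q.2)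
  set DBinv := fderiv ℝ (fun q : ℝ × V => Binv q.1 q.2)
  let ι := ContinuousLinearMap.inr ℝ ℝ V
  let a : V → V := fun y => deriv (fun t : ℝ => A t y) 0
  let L : ℝ → V →L[ℝ] V := fun s => (DB (s, x)).comp ι
  let M : ℝ → V →L[ℝ] V := fun s => (DBinv (s, B s x)).comp ι
  have hAinv0 : ∀ᶠ y in 𝓝 x, Ainv 0 y = y := by
    filter_upwards [hA0, (hasFDerivAt_prodMk_right (𝕜 := ℝ) (0 : ℝ) x).continuousAt.eventually
      hAinv] with y hy h
    simpa [hy] using h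
  have hinner : ∀ᶠ s in 𝓝 (0 : ℝ),
      deriv (fun t : ℝ => Ainv t (Binv s (A t (B s x)))) 0
        = DAinv (0, x) (1, 0) + M s (a (B s x)) := by
    filter_upwards [hgraph.eventually hBinvd, hslice.eventually hAd, hBxtendsto.eventually hA0,
      hline.continuousAt.eventually hBinv] with s hsBinv hsA hsA0 hsx
    have h1 : HasDerivAt (fun t : ℝ => A t (B s x)) (a (B s x)) 0 :=
      (hasDerivAt_time hsA).differentiableAt.hasDerivAt
    have h2 : HasDerivAt (fun t : ℝ => Binv s (A t (B s x))) (M s (a (B s x))) 0 := by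
      refine HasFDerivAt.comp_hasDerivAt_of_eq (f := fun t : ℝ => (s, A t (B s x)))
        (0 : ℝ) hsBinv.hasFDerivAt ((hasDerivAt_const 0 s).prodMk h1) ?_
      simp [hsA0]
    have h3 : HasDerivAt (fun t : ℝ => Ainv t (Binv s (A t (B s x))))
        (DAinv (0, x) (1, M s (a (B s x)))) 0 := by
      refine HasFDerivAt.comp_hasDerivAt_of_eq (f := fun t : ℝ => (t, Binv s (A t (B s x))))
        (0 : ℝ) hAinvd.hasFDerivAt ((hasDerivAt_id 0).prodMk h2) ?_
      simpa [hsA0] using hsx.symm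
    conv_rhs => rw [← fderiv_inr_of_eventually_eq_id hAinvd hAinv0 (M s (a (B s x))), ← map_add]
    simpa using h3.deriv
  have hL : HasDerivAt L ((fderiv ℝ DB (0, x) (1, 0)).comp ι) 0 := by
    have h := hB2.hasFDerivAt.comp_hasDerivAt (0 : ℝ) hline
    simpa using h.clm_comp (hasDerivAt_const (0 : ℝ) ι)
  have hL1 : L 0 = 1 := by
    ext v
    exact fderiv_inr_of_eventually_eq_id hBd.self_of_nhds hB0 v
  have hML : ∀ᶠ s in 𝓝 (0 : ℝ), M s * L s = 1 := by
    filter_upwards [hgraph.eventually hBinvd, hline.continuousAt.eventually hBd,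
      hline.continuousAt.eventually hBinv.eventually_nhds] with s hsBinv hsB hs
    have hpath := hasFDerivAt_prodMk_right (𝕜 := ℝ) s x
    have h1 : HasFDerivAt (fun y => B s y) (L s) x := hsB.hasFDerivAt.comp x hpath
    have h2 : HasFDerivAt (fun y => Binv s (B s y)) ((M s).comp (L s)) x :=
      HasFDerivAt.comp (g := fun z => Binv s z) x
        (hsBinv.hasFDerivAt.comp (B s x) (hasFDerivAt_prodMk_right s (B s x))) h1
    exact h2.unique ((hasFDerivAt_id x).congr_of_eventuallyEq (hpath.continuousAt.eventually hs))
  have hM := hasDerivAt_of_mul_eq_one hL hL1 hML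
  have hM0 : M 0 = 1 := by simpa [hL1] using hML.self_of_nhds
  have ha := (hasFDerivAt_deriv_time hAd hA2).differentiableAt.hasFDerivAt
  have haB : HasDerivAt (fun s => a (B s x)) (fderiv ℝ a x (deriv (fun s => B s x) 0)) 0 :=
    ha.comp_hasDerivAt_of_eq (0 : ℝ) hBx.differentiableAt.hasDerivAt hB0.self_of_nhds.symm
  have hmixed : ∀ v, fderiv ℝ (fun y => deriv (fun s : ℝ => B s y) 0) x v
      = fderiv ℝ DB (0, x) (1, 0) (0, v) := fun v => by
    rw [(hasFDerivAt_deriv_time hBd hB2).fderiv]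
    exact second_derivative_symmetric_of_eventually
      (hBd.mono fun _ hq => hq.hasFDerivAt) hB2.hasFDerivAt (0, v) (1, 0)
  refine (((hM.clm_apply haB).const_add (DAinv (0, x) (1, 0))).congr_of_eventuallyEq
    hinner).congr_deriv ?_
  rw [hmixed, hM0, hB0.self_of_nhds]
  simp [ι, a, sub_eq_neg_add]

end Conjugation

/-- Second mixed derivative of a commutator-like composition.
If `A, B` are `C¹`, equal the identity at time `0`, and are twice
differentiable at `(0,x)`, and `F(t,s,x) = A⁻¹(t, B⁻¹(s, A(t, B(s,x))))`, then
`∂²F/∂t∂s(0,0,x) = ∂²A/∂x∂t(0,x)·∂B/∂s(0,x) − ∂²B/∂s∂x(0,x)·∂A/∂t(0,x)`. -/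
theorem second_mixed_derivative_of_conjugation
    (p : ℕ) (O : Set (E p)) (hO : IsOpen O) (ε : ℝ) (hε : 0 < ε)
    (A B : ℝ → E p → E p)
    (hA : ContDiffOn ℝ 1 (fun q : ℝ × E p => A q.1 q.2) (Ioo (-ε) ε ×ˢ O))
    (hB : ContDiffOn ℝ 1 (fun q : ℝ × E p => B q.1 q.2) (Ioo (-ε) ε ×ˢ O))
    (hA0 : ∀ x ∈ O, A 0 x = x) (hB0 : ∀ x ∈ O, B 0 x = x)
    (hA2 : ∀ x ∈ O, DifferentiableAt ℝ
      (fderiv ℝ (fun q : ℝ × E p => A q.1 q.2)) ((0 : ℝ), x))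
    (hB2 : ∀ x ∈ O, DifferentiableAt ℝ
      (fderiv ℝ (fun q : ℝ × E p => B q.1 q.2)) ((0 : ℝ), x))
    (Ainv Binv : ℝ → E p → E p)
    (hAinv : ∀ᶠ t in 𝓝 (0:ℝ), ∀ y ∈ O, Ainv t (A t y) = y ∧ A t (Ainv t y) = y)
    (hBinv : ∀ᶠ s in 𝓝 (0:ℝ), ∀ y ∈ O, Binv s (B s y) = y ∧ B s (Binv s y) = y) :
    ∀ x ∈ O,
      deriv (fun s : ℝ => deriv (fun t : ℝ => Ainv t (Binv s (A t (B s x)))) 0) 0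
        = fderiv ℝ (fun y => deriv (fun t : ℝ => A t y) 0) x
            (deriv (fun s : ℝ => B s x) 0)
          - fderiv ℝ (fun y => deriv (fun s : ℝ => B s y) 0) x
            (deriv (fun t : ℝ => A t x) 0) := by
  intro x hx
  have h0 : Ioo (-ε) ε ∈ 𝓝 (0 : ℝ) := Ioo_mem_nhds (by linarith) hε
  have hOx : O ∈ 𝓝 x := hO.mem_nhds hx
  have eventually_leftInverse : ∀ {U W : ℝ → E p → E p},
      (∀ᶠ t in 𝓝 (0 : ℝ), ∀ y ∈ O, W t (U t y) = y ∧ U t (W t y) = y) →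
      ∀ᶠ q : ℝ × E p in 𝓝 (0, x), W q.1 (U q.1 q.2) = q.2 := fun hUW => by
    filter_upwards [prod_mem_nhds hUW hOx] with q hq
    exact (hq.1 q.2 hq.2).1
  exact (hasDerivAt_deriv_conjugation (hA.contDiffAt (prod_mem_nhds h0 hOx))
    (hB.contDiffAt (prod_mem_nhds h0 hOx)) (Filter.eventually_of_mem hOx hA0)
    (Filter.eventually_of_mem hOx hB0) (hA2 x hx) (hB2 x hx)
    (eventually_leftInverse hAinv) (eventually_leftInverse hBinv)).deriv

end
end

section
/- (Chow's theorem for nonsmooth vector fields.) Under Assumptions (C): (1) for any x₀ ∈ Ω there exist two neighborhoods U ⊆ V ⊆ Ω of x₀ such that any two points of U can be connected by a curve contained in V which is composed of a finite number of arcs of integral curves of the vector fields X_i, i = 0,1,...,n; (2) if Ω is connected, then for any pair of points x, y ∈ Ω there exists a curve joining x to y, contained in Ω, composed of a finite number of arcs of integral curves of the vector fields X_i, i = 0,1,...,n. -/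
open MeasureTheory Set Topology

noncomputable section

section Approx

open Filter

variable {A B C : Type*} [NormedAddCommGroup A] [NormedSpace ℝ A] [NormedAddCommGroup B]
  [NormedSpace ℝ B] [NormedAddCommGroup C] [NormedSpace ℝ C]

/-- Near `a`, the increments of `F` agree with those of the linear map `L` up to the
factor `ε`. -/
def ApproxAt (F : A → B) (L : A →L[ℝ] B) (a : A) (ε : ℝ) : Prop :=
  ∀ᶠ q in 𝓝 (a, a), ‖F q.1 - F q.2 - L (q.1 - q.2)‖ ≤ ε * ‖q.1 - q.2‖

lemma ApproxAt.mono {F : A → B} {L : A →L[ℝ] B} {a : A} {ε ε' : ℝ}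
    (h : ApproxAt F L a ε) (hε : ε ≤ ε') : ApproxAt F L a ε' := by
  filter_upwards [h] with q hq
  exact hq.trans (by gcongr)

lemma ApproxAt.change {F : A → B} {L : A →L[ℝ] B} {a : A} {ε : ℝ}
    (h : ApproxAt F L a ε) (L' : A →L[ℝ] B) : ApproxAt F L' a (ε + ‖L - L'‖) := by
  filter_upwards [h] with q hq
  have e : F q.1 - F q.2 - L' (q.1 - q.2)
      = (F q.1 - F q.2 - L (q.1 - q.2)) + (L - L') (q.1 - q.2) := by
    simp only [sub_apply]; abel
  rw [e, add_mul]
  exact (norm_add_le _ _).trans (add_le_add hq ((L - L').le_opNorm _))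

lemma ApproxAt.continuousAt {F : A → B} {L : A →L[ℝ] B} {a : A} {ε : ℝ}
    (h : ApproxAt F L a ε) : ContinuousAt F a := by
  have h1 : ∀ᶠ q in 𝓝 a, ‖F q - F a - L (q - a)‖ ≤ ε * ‖q - a‖ := by
    have : Tendsto (fun q : A => (q, a)) (𝓝 a) (𝓝 (a, a)) :=
      (Continuous.prodMk_left a).tendsto a
    exact this.eventually h
  have h2 : Tendsto (fun q => ε * ‖q - a‖) (𝓝 a) (𝓝 0) := by
    have : Continuous fun q : A => ε * ‖q - a‖ := by fun_prop
    simpa using this.tendsto a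
  have h3 : Tendsto (fun q => F q - F a - L (q - a)) (𝓝 a) (𝓝 0) :=
    squeeze_zero_norm' h1 h2
  have h4 : Tendsto (fun q => L (q - a) + F a) (𝓝 a) (𝓝 (F a)) := by
    have : Continuous fun q : A => L (q - a) + F a := by fun_prop
    simpa using this.tendsto a
  have h5 := h3.add h4
  simp only [zero_add] at h5
  refine h5.congr fun q => ?_
  abel

lemma ApproxAt.tendsto {F : A → B} {L : A →L[ℝ] B} {a : A} {b : B} {ε : ℝ}
    (h : ApproxAt F L a ε) (hb : F a = b) : Tendsto F (𝓝 a) (𝓝 b) :=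
  hb ▸ h.continuousAt

lemma ApproxAt.of_linear (L : A →L[ℝ] B) (a : A) : ApproxAt L L a 0 :=
  Eventually.of_forall fun q => by simp

lemma ApproxAt.comp {G : B → C} {F : A → B} {M : B →L[ℝ] C} {L : A →L[ℝ] B} {a : A} {b : B}
    {η ε K : ℝ} (hG : ApproxAt G M b η) (hF : ApproxAt F L a ε) (hb : F a = b) (hη : 0 ≤ η)
    (hK : ‖L‖ + ε ≤ K) : ApproxAt (G ∘ F) (M ∘L L) a (η * K + ‖M‖ * ε) := by
  subst hb
  have hc : Tendsto (Prod.map F F) (𝓝 (a, a)) (𝓝 (F a, F a)) :=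
    hF.continuousAt.prodMap hF.continuousAt
  filter_upwards [hF, hc.eventually hG] with q h1 h2
  simp only [Prod.map_fst, Prod.map_snd] at h2
  have h3 : ‖F q.1 - F q.2‖ ≤ K * ‖q.1 - q.2‖ := by
    have e : F q.1 - F q.2 = (F q.1 - F q.2 - L (q.1 - q.2)) + L (q.1 - q.2) := by abel
    rw [e]
    refine (norm_add_le _ _).trans ?_
    have := L.le_opNorm (q.1 - q.2)
    have := mul_le_mul_of_nonneg_right hK (norm_nonneg (q.1 - q.2))
    linarith
  have e : (G ∘ F) q.1 - (G ∘ F) q.2 - (M ∘L L) (q.1 - q.2)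
      = (G (F q.1) - G (F q.2) - M (F q.1 - F q.2))
        + M (F q.1 - F q.2 - L (q.1 - q.2)) := by
    simp only [Function.comp, ContinuousLinearMap.comp_apply, map_sub]; abel
  rw [e]
  have h4 := M.le_opNorm (F q.1 - F q.2 - L (q.1 - q.2))
  have h5 := mul_le_mul_of_nonneg_left h1 (norm_nonneg M)
  have h6 := mul_le_mul_of_nonneg_left h3 hη
  refine (norm_add_le _ _).trans ?_
  linarith

lemma ApproxAt.prodMk_linear {F : A → B} {M : A →L[ℝ] B} {a : A} {ε : ℝ}
    (hF : ApproxAt F M a ε) (N : A →L[ℝ] C) :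
    ApproxAt (fun q => (N q, F q)) (N.prod M) a ε := by
  filter_upwards [hF] with q h
  have e : (N q.1, F q.1) - (N q.2, F q.2) - N.prod M (q.1 - q.2)
      = (0, F q.1 - F q.2 - M (q.1 - q.2)) := by
    simp
  rw [e, Prod.norm_def, norm_zero]
  exact max_le ((norm_nonneg _).trans h) h

lemma norm_coprod_le_add (L : A →L[ℝ] C) (M : B →L[ℝ] C) :
    ‖L.coprod M‖ ≤ ‖L‖ + ‖M‖ := by
  refine ContinuousLinearMap.opNorm_le_bound _ (by positivity) fun q => ?_
  have h1 := L.le_opNorm_of_le (norm_fst_le q)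
  have h2 := M.le_opNorm_of_le (norm_snd_le q)
  rw [ContinuousLinearMap.coprod_apply, add_mul]
  exact (norm_add_le _ _).trans (add_le_add h1 h2)

end Approx

section Steer

open Filter Relation

variable {V : Type*} [NormedAddCommGroup V] [NormedSpace ℝ V]
variable {P : Type*} [NormedAddCommGroup P] [NormedSpace ℝ P]
variable {Q : Type*} [NormedAddCommGroup Q] [NormedSpace ℝ Q]

/-- A family of maps, parametrized by `P`, that moves each point near `x` along chains of the
relation `S`, fixes `x` at parameter `0`, and whose increments at `(0, x)` agree up to the
factor `ε` with those of `(s, w) ↦ L s + w`. -/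
def Steer (S : V → V → Prop) (x : V) (L : P →L[ℝ] V) (ε : ℝ) : Prop :=
  ∃ f : P × V → V, f (0, x) = x ∧ (∀ᶠ q in 𝓝 (0, x), ReflTransGen S q.2 (f q)) ∧
    ApproxAt f (L.coprod (.id ℝ V)) (0, x) ε

variable {S : V → V → Prop} {x : V}

lemma Steer.mono {L : P →L[ℝ] V} {ε ε' : ℝ} (h : Steer S x L ε) (hε : ε ≤ ε') :
    Steer S x L ε' := by
  obtain ⟨f, h0, hS, ha⟩ := h
  exact ⟨f, h0, hS, ha.mono hε⟩

lemma norm_coprod_id_le (L : P →L[ℝ] V) : ‖L.coprod (.id ℝ V)‖ ≤ ‖L‖ + 1 :=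
  (norm_coprod_le_add L _).trans (by gcongr; exact ContinuousLinearMap.norm_id_le)

lemma Steer.change {L : P →L[ℝ] V} {ε : ℝ} (h : Steer S x L ε) (L' : P →L[ℝ] V) :
    Steer S x L' (ε + ‖L - L'‖) := by
  obtain ⟨f, h0, hS, ha⟩ := h
  refine ⟨f, h0, hS, (ha.change _).mono ?_⟩
  gcongr
  have e : L.coprod (.id ℝ V) - L'.coprod (.id ℝ V)
      = (L - L').coprod (0 : V →L[ℝ] V) := by ext <;> simp
  rw [e]
  exact (norm_coprod_le_add _ _).trans (by rw [norm_zero, add_zero])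

lemma Steer.zero : Steer S x (0 : P →L[ℝ] V) 0 := by
  refine ⟨Prod.snd, rfl, Eventually.of_forall fun q => .refl, Eventually.of_forall fun q => ?_⟩
  simp

lemma Steer.precomp {L : P →L[ℝ] V} {ε : ℝ} (h : Steer S x L ε) (hε : 0 ≤ ε)
    (M : Q →L[ℝ] P) : Steer S x (L ∘L M) (ε * (‖M‖ + 1)) := by
  obtain ⟨f, h0, hS, ha⟩ := h
  let N : Q × V →L[ℝ] P × V := M.prodMap (.id ℝ V)
  have hN0 : N (0, x) = (0, x) := by simp [N]
  have hN : ‖N‖ ≤ ‖M‖ + 1 := by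
    refine ContinuousLinearMap.opNorm_le_bound _ (by positivity) fun q => ?_
    have h1 := M.le_opNorm_of_le (norm_fst_le q)
    have h2 := norm_snd_le q
    have h3 := mul_nonneg (norm_nonneg M) (norm_nonneg q)
    have h4 := norm_nonneg q
    change max ‖M q.1‖ ‖q.2‖ ≤ _
    refine max_le ?_ ?_ <;> linarith
  refine ⟨f ∘ N, by simp [hN0, h0], ?_, ?_⟩
  · have : Tendsto N (𝓝 (0, x)) (𝓝 (0, x)) := by
      simpa only [hN0] using N.continuous.tendsto (0, x)
    filter_upwards [this.eventually hS] with q hq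
    simpa [N] using hq
  · have := ha.comp (ApproxAt.of_linear N (0, x)) hN0 hε (by simpa using hN)
    have e : (L.coprod (.id ℝ V)) ∘L N = (L ∘L M).coprod (.id ℝ V) := by
      ext <;> simp [N]
    rw [e] at this
    simpa using this

lemma Steer.add {L M : P →L[ℝ] V} {ε η : ℝ} (hL : Steer S x L ε) (hM : Steer S x M η)
    (hε : 0 ≤ ε) (hη : 0 ≤ η) :
    Steer S x (L + M) (ε * (‖M‖ + 1 + η) + (‖L‖ + 1) * η) := by
  obtain ⟨f, f0, fS, fa⟩ := hL
  obtain ⟨g, g0, gS, ga⟩ := hM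
  have ha := ga.prodMk_linear (ContinuousLinearMap.fst ℝ P V)
  have h0 : (fun q : P × V => (ContinuousLinearMap.fst ℝ P V q, g q)) (0, x) = (0, x) := by
    simp [g0]
  have hn : ‖(ContinuousLinearMap.fst ℝ P V).prod (M.coprod (.id ℝ V))‖ ≤ ‖M‖ + 1 := by
    rw [ContinuousLinearMap.opNorm_prod, Prod.norm_def]
    refine max_le ((ContinuousLinearMap.norm_fst_le ℝ P V).trans ?_) (norm_coprod_id_le M)
    have := norm_nonneg M
    linarith
  refine ⟨f ∘ fun q => (q.1, g q), by simp [g0, f0], ?_, ?_⟩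
  · filter_upwards [gS, (ha.tendsto h0).eventually fS] with q h1 h2
    exact h1.trans h2
  · have := fa.comp ha h0 hε (add_le_add_left hn η)
    have e : (L.coprod (.id ℝ V)) ∘L
        ((ContinuousLinearMap.fst ℝ P V).prod (M.coprod (.id ℝ V)))
        = (L + M).coprod (.id ℝ V) := by
      ext <;> simp
    rw [e] at this
    refine this.mono ?_
    gcongr
    exact norm_coprod_id_le L

lemma Steer.conj {z : V} {L : P →L[ℝ] V} {Φ Ψ : V → V} {M N : V →L[ℝ] V} {ε K : ℝ}
    (h : Steer S z L ε) (hΦ : Φ x = z) (hΨ : Ψ z = x)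
    (sΦ : ∀ᶠ y in 𝓝 x, ReflTransGen S y (Φ y)) (sΨ : ∀ᶠ y in 𝓝 z, ReflTransGen S y (Ψ y))
    (aΦ : ApproxAt Φ M x ε) (aΨ : ApproxAt Ψ N z ε) (hε : 0 ≤ ε) (hε1 : ε ≤ 1) (hK : 1 ≤ K)
    (hM : ‖M‖ ≤ K) (hN : ‖N‖ ≤ K) (hL : ‖L‖ ≤ K) :
    Steer S x (N ∘L L) ((3 * K ^ 2 + 5 * K + 2) * ε + ‖N ∘L M - .id ℝ V‖) := by
  obtain ⟨f, f0, fS, fa⟩ := h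
  have a1 : ApproxAt (fun q : P × V => (ContinuousLinearMap.fst ℝ P V q, Φ q.2))
      ((ContinuousLinearMap.fst ℝ P V).prod (M ∘L ContinuousLinearMap.snd ℝ P V)) (0, x) ε := by
    have := aΦ.comp (ApproxAt.of_linear (ContinuousLinearMap.snd ℝ P V) (0, x)) rfl hε
      (K := 1) (by simpa using ContinuousLinearMap.norm_snd_le ℝ P V)
    rw [mul_one, mul_zero, add_zero] at this
    exact this.prodMk_linear _
  have h1 : (fun q : P × V => (ContinuousLinearMap.fst ℝ P V q, Φ q.2)) (0, x) = (0, z) := by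
    simp [hΦ]
  have n1 : ‖(ContinuousLinearMap.fst ℝ P V).prod (M ∘L ContinuousLinearMap.snd ℝ P V)‖ ≤ K := by
    rw [ContinuousLinearMap.opNorm_prod, Prod.norm_def]
    refine max_le ((ContinuousLinearMap.norm_fst_le ℝ P V).trans hK) ?_
    refine (ContinuousLinearMap.opNorm_comp_le _ _).trans ?_
    have := ContinuousLinearMap.norm_snd_le ℝ P V
    nlinarith [norm_nonneg M]
  have n2 : ‖L.coprod (.id ℝ V)‖ ≤ K + 1 := (norm_coprod_id_le L).trans (by gcongr)
  have a2 := (fa.comp a1 h1 hε (add_le_add n1 hε1)).mono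
    (ε' := (2 * K + 2) * ε) (by nlinarith)
  have n3 := (ContinuousLinearMap.opNorm_comp_le (L.coprod (.id ℝ V))
    ((ContinuousLinearMap.fst ℝ P V).prod (M ∘L ContinuousLinearMap.snd ℝ P V))).trans
    (mul_le_mul n2 n1 (norm_nonneg _) (by linarith))
  have h2 : (f ∘ fun q : P × V => (ContinuousLinearMap.fst ℝ P V q, Φ q.2)) (0, x) = z := by
    simp [hΦ, f0]
  have a3 := (aΨ.comp a2 h2 hε (K := (K + 1) * K + (2 * K + 2)) (by nlinarith)).mono
    (ε' := (3 * K ^ 2 + 5 * K + 2) * ε) (by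
      have : ‖N‖ * ((2 * K + 2) * ε) ≤ K * ((2 * K + 2) * ε) := by gcongr
      nlinarith)
  refine ⟨_, ?_, ?_, (a3.change _).mono ?_⟩
  · simp only [Function.comp_apply] at h2 ⊢
    rw [h2, hΨ]
  · filter_upwards [(continuous_snd.tendsto ((0 : P), x)).eventually sΦ,
      (a1.tendsto h1).eventually fS, (a2.tendsto h2).eventually sΨ] with q r1 r2 r3
    exact (r1.trans r2).trans r3
  · gcongr
    have e : N ∘L (L.coprod (.id ℝ V)) ∘L
        ((ContinuousLinearMap.fst ℝ P V).prod (M ∘L ContinuousLinearMap.snd ℝ P V))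
        - (N ∘L L).coprod (.id ℝ V) = (0 : P →L[ℝ] V).coprod (N ∘L M - .id ℝ V) := by
      ext <;> simp
    rw [e]
    exact (norm_coprod_le_add _ _).trans (by rw [norm_zero, zero_add])

/-- The velocities at `x` of families of maps that move points along chains of `S`. -/
def steerable (S : V → V → Prop) (x : V) (P : Type*) [NormedAddCommGroup P]
    [NormedSpace ℝ P] : AddSubmonoid (P →L[ℝ] V) where
  carrier := {L | ∀ ε > 0, Steer S x L ε}
  zero_mem' := fun _ hε => Steer.zero.mono hε.le
  add_mem' := by
    intro L M hL hM ε hε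
    have hK : 0 < ‖M‖ + ‖L‖ + 3 := by positivity
    set e := min 1 (ε / (‖M‖ + ‖L‖ + 3)) with he
    have e0 : 0 < e := lt_min one_pos (by positivity)
    have e1 : e ≤ 1 := min_le_left _ _
    have e2 : e * (‖M‖ + ‖L‖ + 3) ≤ ε := (le_div_iff₀ hK).1 (min_le_right _ _)
    refine ((hL e e0).add (hM e e0) e0.le e0.le).mono ?_
    nlinarith

lemma steerable_precomp {L : P →L[ℝ] V} (h : L ∈ steerable S x P) (M : Q →L[ℝ] P) :
    L ∘L M ∈ steerable S x Q := by
  intro ε hε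
  have hM : 0 < ‖M‖ + 1 := by positivity
  refine ((h (ε / (‖M‖ + 1)) (by positivity)).precomp (by positivity) M).mono ?_
  rw [div_mul_cancel₀ _ hM.ne']

/-- The vectors `v` such that points near `x` can be moved along chains of `S` with velocity
arbitrarily close to `v`. -/
def steerVel (S : V → V → Prop) (x : V) : Submodule ℝ V where
  carrier := {v | ContinuousLinearMap.toSpanSingleton ℝ v ∈ steerable S x ℝ}
  zero_mem' := by
    simp
  add_mem' := by
    intro v w hv hw
    simpa [ContinuousLinearMap.toSpanSingleton_add] using (steerable S x ℝ).add_mem hv hw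
  smul_mem' := by
    intro c v hv
    have e : ContinuousLinearMap.toSpanSingleton ℝ (c • v)
        = ContinuousLinearMap.toSpanSingleton ℝ v ∘L (c • .id ℝ ℝ) := by
      ext; simp
    rw [Set.mem_ofPred_eq, e]
    exact steerable_precomp hv _

lemma eventually_reflTransGen_of_steerVel_eq_top [FiniteDimensional ℝ V]
    (h : steerVel S x = ⊤) : ∀ᶠ y in 𝓝 x, ReflTransGen S x y := by
  have hid : ContinuousLinearMap.id ℝ V ∈ steerable S x V := by
    let b := Module.finBasis ℝ V
    have e : ContinuousLinearMap.id ℝ V = ∑ i, ContinuousLinearMap.toSpanSingleton ℝ (b i) ∘L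
        (LinearMap.toContinuousLinearMap (b.coord i)) := by
      ext v
      simp [b.sum_repr]
    rw [e]
    refine AddSubmonoid.sum_mem _ fun i _ => steerable_precomp ?_ _
    have : b i ∈ steerVel S x := h ▸ Submodule.mem_top
    exact this
  obtain ⟨f, f0, fS, fa⟩ := hid (1 / 2) (by norm_num)
  have hg : ApproxAt (fun u => f (u, x)) (.id ℝ V) 0 (1 / 2) := by
    have hJ : Tendsto (fun q : V × V => ((q.1, x), (q.2, x))) (𝓝 (0, 0))
        (𝓝 ((0, x), (0, x))) := by
      have : Continuous fun q : V × V => ((q.1, x), (q.2, x)) := by fun_prop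
      exact this.tendsto (0, 0)
    filter_upwards [hJ.eventually fa] with q hq
    simpa using hq
  have hg' : ∀ᶠ q in 𝓝 (0 : V) ×ˢ 𝓝 (0 : V),
      ‖f (q.1, x) - f (q.2, x) - (q.1 - q.2)‖ ≤ 1 / 2 * ‖q.1 - q.2‖ := by
    rw [← nhds_prod_eq]
    exact hg
  obtain ⟨s, hs, hg⟩ := eventually_prod_self_iff'.1 hg'
  have hlin : ApproximatesLinearOn (fun u => f (u, x)) (.id ℝ V) s (1 / 2) := by
    intro u hu v hv
    simpa using hg u hu v hv
  let inv : (ContinuousLinearMap.id ℝ V).NonlinearRightInverse :=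
    ⟨id, 1, by simp, fun _ => rfl⟩
  have hmap := hlin.map_nhds_eq inv hs (Or.inr (by
    rw [show inv.nnnorm = 1 from rfl, inv_one]; exact NNReal.half_lt_self one_ne_zero))
  rw [f0] at hmap
  rw [← hmap]
  have hJ : Tendsto (fun u : V => (u, x)) (𝓝 0) (𝓝 (0, x)) :=
    (Continuous.prodMk_left x).tendsto 0
  exact hJ.eventually fS

end Steer


section Flow

open Filter Metric

lemma exists_forall_ball_of_eventually {V : Type*} [PseudoMetricSpace V] {x : V}
    {p : ℝ × V → Prop} (h : ∀ᶠ q in 𝓝 ((0 : ℝ), x), p q) :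
    ∃ ρ > 0, ∀ t ∈ ball (0 : ℝ) ρ, ∀ y ∈ ball x ρ, p (t, y) := by
  obtain ⟨ρ, hρ, h⟩ := eventually_nhds_iff_ball.1 h
  exact ⟨ρ, hρ, fun t ht y hy => h (t, y) (by rw [← ball_prod_same]; exact ⟨ht, hy⟩)⟩

variable {V : Type*} [NormedAddCommGroup V] [NormedSpace ℝ V]

/-- `φ` is, near `(0, x)`, a flow of `X` which is `K`-Lipschitz in the initial point. -/
structure IsLocalFlowAt (X : V → V) (φ : ℝ → V → V) (x : V) (K : ℝ) : Prop where
  continuousAt : ContinuousAt (fun q : ℝ × V => φ q.1 q.2) (0, x)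
  flow : ∀ᶠ q in 𝓝 ((0 : ℝ), x),
    φ 0 q.2 = q.2 ∧ HasDerivAt (fun s => φ s q.2) (X (φ q.1 q.2)) q.1
  lipschitz : ∀ᶠ q in 𝓝 ((0 : ℝ), x, x),
    ‖φ q.1 q.2.1 - φ q.1 q.2.2‖ ≤ K * ‖q.2.1 - q.2.2‖

lemma exists_isLocalFlowAt [CompleteSpace V] {X : V → V} {x : V} (hX : ContDiffAt ℝ 1 X x) :
    ∃ (φ : ℝ → V → V) (K : ℝ), 0 ≤ K ∧ IsLocalFlowAt X φ x K := by
  obtain ⟨ε, hε, a, r, L, k, hr, hP⟩ := IsPicardLindelof.of_contDiffAt_one hX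
  obtain ⟨α, hα, K, hK⟩ :=
    (hP 0).exists_forall_mem_closedBall_eq_hasDerivWithinAt_lipschitzOnWith
  have hI : Icc (0 - ε) (0 + ε) ∈ 𝓝 (0 : ℝ) := Icc_mem_nhds (by linarith) (by linarith)
  have hI' : Ioo (0 - ε) (0 + ε) ∈ 𝓝 (0 : ℝ) := Ioo_mem_nhds (by linarith) (by linarith)
  have hB : closedBall x (r : ℝ) ∈ 𝓝 x := closedBall_mem_nhds x (by exact_mod_cast hr)
  refine ⟨fun t y => α y t, K, K.2, ?_, ?_, ?_⟩
  · have hc : ContinuousOn (Function.uncurry α) (closedBall x r ×ˢ Icc (0 - ε) (0 + ε)) :=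
      continuousOn_prod_of_continuousOn_lipschitzOnWith _ K
        (fun y hy => HasDerivWithinAt.continuousOn (hα y hy).2) hK
    have h1 : ContinuousAt (Function.uncurry α) (x, 0) :=
      hc.continuousAt (prod_mem_nhds hB hI)
    exact ContinuousAt.comp (f := Prod.swap) (x := ((0 : ℝ), x)) h1
      continuous_swap.continuousAt
  · filter_upwards [prod_mem_nhds hI' hB] with q hq
    exact ⟨(hα _ hq.2).1, ((hα _ hq.2).2 _ (Ioo_subset_Icc_self hq.1)).hasDerivAt
      (Icc_mem_nhds hq.1.1 hq.1.2)⟩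
  · filter_upwards [prod_mem_nhds hI (prod_mem_nhds hB hB)] with q hq
    exact (hK _ hq.1).norm_sub_le hq.2.1 hq.2.2

variable {X : V → V} {φ : ℝ → V → V} {x : V} {K : ℝ}

lemma IsLocalFlowAt.map_zero (h : IsLocalFlowAt X φ x K) : φ 0 x = x :=
  h.flow.self_of_nhds.1

lemma IsLocalFlowAt.tendsto (h : IsLocalFlowAt X φ x K) :
    Tendsto (fun q : ℝ × V => φ q.1 q.2) (𝓝 (0, x)) (𝓝 x) := by
  simpa only [ContinuousAt, h.map_zero] using h.continuousAt

lemma IsLocalFlowAt.hasDerivAt (h : IsLocalFlowAt X φ x K) :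
    HasDerivAt (fun t => φ t x) (X x) 0 := by
  simpa only [h.map_zero] using h.flow.self_of_nhds.2

lemma IsLocalFlowAt.tendsto_at (h : IsLocalFlowAt X φ x K) :
    Tendsto (fun t => φ t x) (𝓝 0) (𝓝 x) := by
  simpa only [ContinuousAt, h.map_zero] using h.hasDerivAt.continuousAt

/-- First order expansion in time, uniform in the initial points, of the increments of the
flow. -/
lemma IsLocalFlowAt.eventually_increment (h : IsLocalFlowAt X φ x K) (hK : 0 ≤ K)
    (hX : ContDiffAt ℝ 1 X x) {η : ℝ} (hη : 0 < η) :
    ∀ᶠ q in 𝓝 ((0 : ℝ), x, x), ‖φ q.1 q.2.1 - φ q.1 q.2.2 - (q.2.1 - q.2.2)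
      - q.1 • fderiv ℝ X x (q.2.1 - q.2.2)‖ ≤ η * |q.1| * ‖q.2.1 - q.2.2‖ := by
  set A := fderiv ℝ X x with hA
  have hs : HasStrictFDerivAt X A x := hX.hasStrictFDerivAt one_ne_zero
  obtain ⟨c, hc, hcK⟩ : ∃ c > 0, c * K ≤ η / 2 := by
    refine ⟨η / (2 * (K + 1)), by positivity, ?_⟩
    rw [div_mul_eq_mul_div, div_le_div_iff₀ (by positivity) (by positivity)]
    nlinarith
  have hX' : ∀ᶠ q in 𝓝 (x, x), ‖X q.1 - X q.2 - A (q.1 - q.2)‖ ≤ c * ‖q.1 - q.2‖ :=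
    hs.isLittleO.def hc
  have t1 : Tendsto (fun q : ℝ × V × V => (q.1, q.2.1)) (𝓝 (0, x, x)) (𝓝 (0, x)) :=
    (show Continuous fun q : ℝ × V × V => (q.1, q.2.1) by fun_prop).tendsto (0, x, x)
  have t2 : Tendsto (fun q : ℝ × V × V => (q.1, q.2.2)) (𝓝 (0, x, x)) (𝓝 (0, x)) :=
    (show Continuous fun q : ℝ × V × V => (q.1, q.2.2) by fun_prop).tendsto (0, x, x)
  have hX'' := ((h.tendsto.comp t1).prodMk_nhds (h.tendsto.comp t2)).eventually hX'
  have hall := (hX''.and h.lipschitz).and ((t1.eventually h.flow).and (t2.eventually h.flow))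
  obtain ⟨ρ, hρ, hall⟩ := eventually_nhds_iff_ball.1 hall
  obtain ⟨σ, hσ, hσρ, hση⟩ : ∃ σ > 0, σ ≤ ρ ∧ ‖A‖ * ((c + ‖A‖) * K * σ) ≤ η / 2 := by
    refine ⟨min ρ (η / (2 * (‖A‖ * ((c + ‖A‖) * K) + 1))), lt_min hρ (by positivity),
      min_le_left _ _, ?_⟩
    have h1 := min_le_right ρ (η / (2 * (‖A‖ * ((c + ‖A‖) * K) + 1)))
    have h2 : 0 ≤ ‖A‖ * ((c + ‖A‖) * K) := by positivity
    rw [le_div_iff₀ (by positivity)] at h1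
    have h3 : 0 < min ρ (η / (2 * (‖A‖ * ((c + ‖A‖) * K) + 1))) :=
      lt_min hρ (by positivity)
    nlinarith
  filter_upwards [ball_mem_nhds ((0 : ℝ), x, x) hσ] with q hq
  obtain ⟨t, y, z⟩ := q
  rw [← ball_prod_same, ← ball_prod_same] at hq
  obtain ⟨ht, hy, hz⟩ := hq
  simp only at ht hy hz ⊢
  have hmem : ∀ s ∈ ball (0 : ℝ) σ, (s, y, z) ∈ ball ((0 : ℝ), x, x) ρ := by
    intro s hs
    rw [← ball_prod_same, ← ball_prod_same]
    exact ⟨ball_subset_ball hσρ hs, ball_subset_ball hσρ hy, ball_subset_ball hσρ hz⟩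
  have h0 : (0 : ℝ) ∈ ball (0 : ℝ) σ := mem_ball_self hσ
  have hy0 : φ 0 y = y := (hall _ (hmem 0 h0)).2.1.1
  have hz0 : φ 0 z = z := (hall _ (hmem 0 h0)).2.2.1
  have hd : ∀ s ∈ ball (0 : ℝ) σ,
      HasDerivAt (fun s => φ s y - φ s z) (X (φ s y) - X (φ s z)) s := fun s hs =>
    (hall _ (hmem s hs)).2.1.2.sub (hall _ (hmem s hs)).2.2.2
  have hb1 : ∀ s ∈ ball (0 : ℝ) σ,
      ‖X (φ s y) - X (φ s z) - A (φ s y - φ s z)‖ ≤ c * K * ‖y - z‖ := by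
    intro s hs
    obtain ⟨⟨e1, e2⟩, -⟩ := hall _ (hmem s hs)
    simp only [Function.comp] at e1 e2
    rw [mul_assoc]
    exact e1.trans (by gcongr)
  have hb2 : ∀ s ∈ ball (0 : ℝ) σ, ‖X (φ s y) - X (φ s z)‖ ≤ (c + ‖A‖) * K * ‖y - z‖ := by
    intro s hs
    have e1 := hb1 s hs
    have e2 := (hall _ (hmem s hs)).1.2
    simp only at e2
    have e3 := A.le_opNorm_of_le e2
    have e4 := norm_add_le (X (φ s y) - X (φ s z) - A (φ s y - φ s z)) (A (φ s y - φ s z))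
    rw [sub_add_cancel] at e4
    linarith
  have hb3 : ∀ s ∈ ball (0 : ℝ) σ,
      ‖φ s y - φ s z - (y - z)‖ ≤ (c + ‖A‖) * K * σ * ‖y - z‖ := by
    intro s hs
    have := (convex_ball (0 : ℝ) σ).norm_image_sub_le_of_norm_hasDerivWithin_le
      (fun s hs => (hd s hs).hasDerivWithinAt) hb2 h0 hs
    rw [hy0, hz0, sub_zero, Real.norm_eq_abs] at this
    have h2 : |s| ≤ σ := by
      rw [mem_ball_zero_iff, Real.norm_eq_abs] at hs; exact hs.le
    calc _ ≤ _ := this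
      _ ≤ (c + ‖A‖) * K * ‖y - z‖ * σ := by gcongr
      _ = _ := by ring
  have hd' : ∀ s ∈ ball (0 : ℝ) σ,
      HasDerivAt (fun s => φ s y - φ s z - s • A (y - z))
        (X (φ s y) - X (φ s z) - (1 : ℝ) • A (y - z)) s := fun s hs =>
    (hd s hs).sub ((hasDerivAt_id s).smul_const _)
  have hb4 : ∀ s ∈ ball (0 : ℝ) σ,
      ‖X (φ s y) - X (φ s z) - (1 : ℝ) • A (y - z)‖ ≤ η * ‖y - z‖ := by
    intro s hs
    have e : X (φ s y) - X (φ s z) - (1 : ℝ) • A (y - z)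
        = (X (φ s y) - X (φ s z) - A (φ s y - φ s z)) + A (φ s y - φ s z - (y - z)) := by
      rw [one_smul, map_sub A (φ s y - φ s z)]; abel
    rw [e]
    have e1 := A.le_opNorm_of_le (hb3 s hs)
    refine (norm_add_le _ _).trans ?_
    have e2 := hb1 s hs
    have e3 := mul_le_mul_of_nonneg_right (add_le_add hcK hση) (norm_nonneg (y - z))
    linarith
  have := (convex_ball (0 : ℝ) σ).norm_image_sub_le_of_norm_hasDerivWithin_le
    (fun s hs => (hd' s hs).hasDerivWithinAt) hb4 h0 ht
  rw [hy0, hz0, zero_smul, sub_zero, sub_zero, Real.norm_eq_abs] at this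
  calc _ = ‖φ t y - φ t z - t • A (y - z) - (y - z)‖ := by congr 1; abel
    _ ≤ _ := this
    _ = _ := by ring

lemma IsLocalFlowAt.eventually_approxAt (h : IsLocalFlowAt X φ x K) (hK : 0 ≤ K)
    (hX : ContDiffAt ℝ 1 X x) {η : ℝ} (hη : 0 < η) :
    ∀ᶠ q in 𝓝 ((0 : ℝ), x),
      ApproxAt (φ q.1) (.id ℝ V + q.1 • fderiv ℝ X x) q.2 (η * |q.1|) := by
  have h1 := (h.eventually_increment hK hX hη).eventually_nhds
  have t1 : Tendsto (fun q : ℝ × V => (q.1, q.2, q.2)) (𝓝 (0, x)) (𝓝 (0, x, x)) :=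
    (show Continuous fun q : ℝ × V => (q.1, q.2, q.2) by fun_prop).tendsto (0, x)
  filter_upwards [t1.eventually h1] with q hq
  have t2 : Tendsto (fun u : V × V => (q.1, u.1, u.2)) (𝓝 (q.2, q.2)) (𝓝 (q.1, q.2, q.2)) :=
    (show Continuous fun u : V × V => (q.1, u.1, u.2) by fun_prop).tendsto (q.2, q.2)
  filter_upwards [t2.eventually hq] with u hu
  have e : φ q.1 u.1 - φ q.1 u.2 - (.id ℝ V + q.1 • fderiv ℝ X x : V →L[ℝ] V) (u.1 - u.2)
      = φ q.1 u.1 - φ q.1 u.2 - (u.1 - u.2) - q.1 • fderiv ℝ X x (u.1 - u.2) := by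
    rw [add_apply, smul_apply, ContinuousLinearMap.id_apply, sub_sub _ (u.1 - u.2)]
  rw [e]
  exact hu

lemma IsLocalFlowAt.approxAt (h : IsLocalFlowAt X φ x K) (hK : 0 ≤ K)
    (hX : ContDiffAt ℝ 1 X x) {ε : ℝ} (hε : 0 < ε) :
    ApproxAt (fun q : ℝ × V => φ q.1 q.2)
      ((ContinuousLinearMap.toSpanSingleton ℝ (X x)).coprod (.id ℝ V)) (0, x) ε := by
  set A := fderiv ℝ X x with hA
  have hXc : ∀ᶠ q in 𝓝 ((0 : ℝ), x), ‖X (φ q.1 q.2) - X x‖ < ε / 2 := by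
    have := hX.continuousAt.tendsto.comp h.tendsto
    simpa [dist_eq_norm] using this.eventually (ball_mem_nhds (X x) (half_pos hε))
  obtain ⟨ρ, hρ, h1⟩ := exists_forall_ball_of_eventually (h.flow.and hXc)
  have t1 : Tendsto (fun q : (ℝ × V) × (ℝ × V) => (q.1.1, q.1.2, q.2.2))
      (𝓝 ((0, x), (0, x))) (𝓝 (0, x, x)) :=
    (show Continuous fun q : (ℝ × V) × (ℝ × V) => (q.1.1, q.1.2, q.2.2) by
      fun_prop).tendsto ((0, x), (0, x))
  have t2 : Tendsto (fun q : (ℝ × V) × (ℝ × V) => (1 + ‖A‖) * |q.1.1|)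
      (𝓝 ((0, x), (0, x))) (𝓝 0) := by
    simpa using (show Continuous fun q : (ℝ × V) × (ℝ × V) => (1 + ‖A‖) * |q.1.1| by
      fun_prop).tendsto ((0, x), (0, x))
  have hball : ∀ᶠ q in 𝓝 (((0 : ℝ), x), ((0 : ℝ), x)),
      (q.1.1 ∈ ball (0 : ℝ) ρ ∧ q.1.2 ∈ ball x ρ) ∧
        q.2.1 ∈ ball (0 : ℝ) ρ ∧ q.2.2 ∈ ball x ρ :=
    prod_mem_nhds (prod_mem_nhds (ball_mem_nhds _ hρ) (ball_mem_nhds _ hρ))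
      (prod_mem_nhds (ball_mem_nhds _ hρ) (ball_mem_nhds _ hρ))
  filter_upwards [t1.eventually (h.eventually_increment hK hX one_pos),
    t2.eventually (gt_mem_nhds (half_pos hε)), hball] with q h2 h3 h4
  obtain ⟨⟨t, y⟩, ⟨s, z⟩⟩ := q
  simp only at h2 h3 h4 ⊢
  obtain ⟨⟨ht, hy⟩, ⟨hs, hz⟩⟩ := h4
  have e1 : ‖φ t y - φ t z - (y - z)‖ ≤ ε / 2 * ‖y - z‖ := by
    have e2 := norm_add_le (φ t y - φ t z - (y - z) - t • A (y - z)) (t • A (y - z))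
    rw [sub_add_cancel, norm_smul, Real.norm_eq_abs] at e2
    have e3 := mul_le_mul_of_nonneg_left (A.le_opNorm (y - z)) (abs_nonneg t)
    have e4 := mul_le_mul_of_nonneg_right h3.le (norm_nonneg (y - z))
    nlinarith
  have e2 : ‖φ t z - φ s z - (t - s) • X x‖ ≤ ε / 2 * ‖t - s‖ := by
    have := (convex_ball (0 : ℝ) ρ).norm_image_sub_le_of_norm_hasDerivWithin_le
      (f := fun u => φ u z - u • X x) (f' := fun u => X (φ u z) - (1 : ℝ) • X x)
      (C := ε / 2)
      (fun u hu => ((h1 u hu z hz).1.2.sub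
        ((hasDerivAt_id u).smul_const (X x))).hasDerivWithinAt)
      (fun u hu => by rw [one_smul]; exact (h1 u hu z hz).2.le) hs ht
    refine le_of_eq_of_le ?_ this
    rw [sub_smul]; congr 1; abel
  have e3 : φ t y - φ s z - ((ContinuousLinearMap.toSpanSingleton ℝ (X x)).coprod (.id ℝ V))
      ((t, y) - (s, z)) = (φ t y - φ t z - (y - z)) + (φ t z - φ s z - (t - s) • X x) := by
    simp; abel
  rw [e3]
  refine (norm_add_le _ _).trans ?_
  have n1 : ‖y - z‖ ≤ ‖(t, y) - (s, z)‖ := norm_snd_le ((t, y) - (s, z))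
  have n2 : ‖t - s‖ ≤ ‖(t, y) - (s, z)‖ := norm_fst_le ((t, y) - (s, z))
  nlinarith

lemma IsLocalFlowAt.eventually_neg_map (h : IsLocalFlowAt X φ x K)
    (hX : ContDiffAt ℝ 1 X x) : ∀ᶠ t in 𝓝 (0 : ℝ), φ (-t) (φ t x) = x := by
  obtain ⟨k, s, hs, hl⟩ := hX.exists_lipschitzOnWith
  obtain ⟨ρ, hρ, h1⟩ := exists_forall_ball_of_eventually
    (h.flow.and (h.tendsto.eventually_mem hs))
  have hρ2 : 0 < ρ / 2 := by positivity
  filter_upwards [ball_mem_nhds (0 : ℝ) hρ2, h.tendsto_at.eventually_mem (ball_mem_nhds x hρ)]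
    with t ht hxt
  have hx := mem_ball_self (x := x) hρ
  rw [Real.ball_eq_Ioo, zero_sub, zero_add] at ht
  have hsub : ∀ u ∈ Ioo (-(ρ / 2)) (ρ / 2), u ∈ ball (0 : ℝ) ρ ∧ u + t ∈ ball (0 : ℝ) ρ := by
    intro u hu
    rw [Real.ball_eq_Ioo]
    obtain ⟨h3, h4⟩ := hu
    obtain ⟨h5, h6⟩ := ht
    refine ⟨⟨?_, ?_⟩, ⟨?_, ?_⟩⟩ <;> linarith
  have := ODE_solution_unique_of_mem_Ioo (v := fun _ => X) (s := fun _ => s) (K := k)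
    (f := fun u => φ u (φ t x)) (g := fun u => φ (u + t) x) (t₀ := 0)
    (a := -(ρ / 2)) (b := ρ / 2) (fun _ _ => hl) ⟨by linarith, hρ2⟩
    (fun u hu => ⟨(h1 u (hsub u hu).1 _ hxt).1.2, (h1 u (hsub u hu).1 _ hxt).2⟩)
    (fun u hu => ⟨(h1 (u + t) (hsub u hu).2 _ hx).1.2.comp_add_const u t,
      (h1 (u + t) (hsub u hu).2 _ hx).2⟩)
    (by
      simp only [zero_add]
      exact (h1 0 (mem_ball_self hρ) _ hxt).1.1)
  have h2 := this (x := -t) ⟨by linarith [ht.2], by linarith [ht.1]⟩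
  simpa [h.map_zero] using h2

end Flow

section Bracket

open Filter Relation

variable {V : Type*} [NormedAddCommGroup V] [NormedSpace ℝ V]
variable {X Y : V → V} {φ : ℝ → V → V} {x : V} {K : ℝ} {S : V → V → Prop}

lemma IsLocalFlowAt.mem_steerVel (h : IsLocalFlowAt X φ x K) (hK : 0 ≤ K)
    (hX : ContDiffAt ℝ 1 X x) (hS : ∀ᶠ q in 𝓝 ((0 : ℝ), x), ReflTransGen S q.2 (φ q.1 q.2)) :
    X x ∈ steerVel S x :=
  fun _ hε => ⟨fun q => φ q.1 q.2, h.map_zero, hS, h.approxAt hK hX hε⟩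

/-- The velocity of `Y`, transported back along the flow of `X`, has derivative `[X, Y]`. -/
lemma IsLocalFlowAt.hasDerivAt_transport (h : IsLocalFlowAt X φ x K)
    (hY : DifferentiableAt ℝ Y x) :
    HasDerivAt (fun t : ℝ => Y (φ t x) - t • fderiv ℝ X x (Y (φ t x))) (vComm X Y x) 0 := by
  have h1 : HasDerivAt (fun t => Y (φ t x)) (fderiv ℝ Y x (X x)) 0 := by
    have hY' : HasFDerivAt Y (fderiv ℝ Y x) (φ 0 x) := by
      rw [h.map_zero]; exact hY.hasFDerivAt
    exact hY'.comp_hasDerivAt 0 h.hasDerivAt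
  have h2 := (fderiv ℝ X x).hasFDerivAt.comp_hasDerivAt (0 : ℝ) h1
  have h3 := h1.sub ((hasDerivAt_id (0 : ℝ)).smul h2)
  refine h3.congr_deriv ?_
  simp [vComm, h.map_zero]

lemma IsLocalFlowAt.vComm_mem_steerVel (h : IsLocalFlowAt X φ x K) (hK : 0 ≤ K)
    (hX : ContDiffAt ℝ 1 X x) (hS : ∀ᶠ q in 𝓝 ((0 : ℝ), x), ReflTransGen S q.2 (φ q.1 q.2))
    (hY : DifferentiableAt ℝ Y x) (hT : ∀ᶠ z in 𝓝 x, Y z ∈ steerVel S z) :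
    vComm X Y x ∈ steerVel S x := by
  intro ε hε
  set A := fderiv ℝ X x with hA
  obtain ⟨B, hB⟩ : ∃ B, B = ‖Y x‖ + ‖A‖ + 2 := ⟨_, rfl⟩
  have hY0 := norm_nonneg (Y x)
  have hA0 := norm_nonneg A
  have hB1 : 2 ≤ B := by linarith
  obtain ⟨C, hC⟩ : ∃ C, C = 3 * B ^ 2 + 5 * B + 2 := ⟨_, rfl⟩
  have hC0 : 0 < C := by rw [hC]; positivity
  obtain ⟨η, hη, hη1, hηε⟩ : ∃ η > 0, η ≤ 1 ∧ 4 * (B + 2) * C * η ≤ ε / 3 := by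
    have hD : 0 < 4 * (B + 2) * C := by positivity
    refine ⟨min 1 (ε / 3 / (4 * (B + 2) * C)), lt_min one_pos (by positivity),
      min_le_left _ _, ?_⟩
    rw [mul_comm]
    exact (le_div_iff₀ hD).1 (min_le_right _ _)
  have hslope := hasDerivAt_iff_tendsto_slope_zero.1 (h.hasDerivAt_transport hY)
  have hslope' := (hslope.mono_left (nhdsGT_le_nhdsNE 0)).eventually
    (Metric.ball_mem_nhds _ (show 0 < ε / 3 by positivity))
  have t1 : Tendsto (fun t : ℝ => (t, x)) (𝓝 0) (𝓝 (0, x)) :=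
    (Continuous.prodMk_left x).tendsto 0
  have t2 : Tendsto (fun t : ℝ => (-t, φ t x)) (𝓝 0) (𝓝 (0, x)) := by
    have := (continuous_neg.tendsto (0 : ℝ)).prodMk_nhds h.tendsto_at
    rwa [neg_zero] at this
  have hsmall : ∀ᶠ t in 𝓝 (0 : ℝ), t ≤ 1 ∧ 2 * (B + 2) * ‖A‖ ^ 2 * t ≤ ε / 3 := by
    have : Tendsto (fun t : ℝ => 2 * (B + 2) * ‖A‖ ^ 2 * t) (𝓝 0) (𝓝 0) := by
      simpa using (continuous_const_mul (2 * (B + 2) * ‖A‖ ^ 2)).tendsto (0 : ℝ)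
    filter_upwards [ge_mem_nhds (zero_lt_one (α := ℝ)),
      this.eventually (ge_mem_nhds (show 0 < ε / 3 by positivity))] with t a b using ⟨a, b⟩
  have hYn : ∀ᶠ t in 𝓝 (0 : ℝ), ‖Y (φ t x)‖ ≤ ‖Y x‖ + 1 :=
    ((hY.continuousAt.tendsto.comp h.tendsto_at).norm).eventually
      (ge_mem_nhds (lt_add_one ‖Y x‖))
  have hap := h.eventually_approxAt hK hX hη
  have hev := (((t1.eventually hap).and (t2.eventually hap)).and
    ((t1.eventually hS.eventually_nhds).and (t2.eventually hS.eventually_nhds))).and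
    ((hsmall.and hYn).and ((h.eventually_neg_map hX).and (h.tendsto_at.eventually hT)))
  obtain ⟨t, ⟨ht0, hsl⟩, ⟨⟨aΦ, aΨ⟩, ⟨sΦ, sΨ⟩⟩, ⟨⟨ht1, htε⟩, hYt⟩, hneg, hTt⟩ :=
    ((eventually_mem_nhdsWithin.and hslope').and (hev.filter_mono nhdsWithin_le_nhds)).exists
  simp only [mem_Ioi, zero_add, h.map_zero, zero_smul, sub_zero, dist_eq_norm]
    at ht0 hsl aΦ aΨ sΦ sΨ hneg hTt
  rw [abs_of_pos ht0] at aΦ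
  rw [abs_neg, abs_of_pos ht0] at aΨ
  have sec : ∀ (s : ℝ) (y : V), (∀ᶠ q in 𝓝 (s, y), ReflTransGen S q.2 (φ q.1 q.2)) →
      ∀ᶠ y' in 𝓝 y, ReflTransGen S y' (φ s y') := fun s y hq =>
    ((Continuous.prodMk_right s).tendsto y).eventually hq
  have he0 : 0 < η * t := by positivity
  have he1 : η * t ≤ 1 := by nlinarith
  have hNM : ∀ s : ℝ, |s| ≤ 1 → ‖ContinuousLinearMap.id ℝ V + s • A‖ ≤ B := by
    intro s hs
    refine (norm_add_le _ _).trans ?_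
    rw [norm_smul, Real.norm_eq_abs]
    have := ContinuousLinearMap.norm_id_le (𝕜 := ℝ) (E := V)
    nlinarith
  have hM := hNM t (by rwa [abs_of_pos ht0])
  have hN := hNM (-t) (by rwa [abs_neg, abs_of_pos ht0])
  have hL : ‖ContinuousLinearMap.toSpanSingleton ℝ (Y (φ t x))‖ ≤ B := by
    rw [ContinuousLinearMap.norm_toSpanSingleton]; linarith
  have hcomp : ‖(.id ℝ V + (-t) • A) ∘L (.id ℝ V + t • A) - .id ℝ V‖ ≤ t ^ 2 * ‖A‖ ^ 2 := by
    have e : (.id ℝ V + (-t) • A) ∘L (.id ℝ V + t • A) - .id ℝ V = (-t ^ 2) • (A ∘L A) := by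
      ext v
      simp [smul_smul, pow_two]
    rw [e, norm_smul, Real.norm_eq_abs, abs_neg, abs_of_nonneg (by positivity)]
    have := ContinuousLinearMap.opNorm_comp_le A A
    rw [pow_two ‖A‖]
    gcongr
  have s1 := ((hTt (η * t) he0).conj rfl hneg (sec _ _ sΦ) (sec _ _ sΨ) aΦ aΨ he0.le he1
    (by linarith) hM hN hL).mono (ε' := C * (η * t) + t ^ 2 * ‖A‖ ^ 2) (by rw [hC]; gcongr)
  have hYx : -Y x ∈ steerVel S x := (steerVel S x).neg_mem hT.self_of_nhds
  have s2 := s1.add (hYx (η * t) he0) (by positivity) he0.le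
  have hNL : ‖(.id ℝ V + (-t) • A) ∘L ContinuousLinearMap.toSpanSingleton ℝ (Y (φ t x))‖
      ≤ B * B :=
    (ContinuousLinearMap.opNorm_comp_le _ _).trans (by gcongr)
  have s3 := s2.mono (ε' := (B + 2) * (2 * C * η + t * ‖A‖ ^ 2) * t) (by
    rw [ContinuousLinearMap.norm_toSpanSingleton, norm_neg]
    have b1 : ‖Y x‖ + 1 + η * t ≤ B + 2 := by linarith
    have b2 : ‖(.id ℝ V + (-t) • A) ∘L ContinuousLinearMap.toSpanSingleton ℝ (Y (φ t x))‖ + 1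
      ≤ (B + 2) * C := by
      rw [hC]; nlinarith
    have b3 : 0 ≤ C * (η * t) + t ^ 2 * ‖A‖ ^ 2 := by positivity
    have b4 := mul_le_mul_of_nonneg_left b1 b3
    have b5 := mul_le_mul_of_nonneg_right b2 he0.le
    nlinarith)
  have s4 := (s3.precomp (by positivity) (t⁻¹ • .id ℝ ℝ)).change
    (ContinuousLinearMap.toSpanSingleton ℝ (vComm X Y x))
  refine s4.mono ?_
  have e : (((.id ℝ V + (-t) • A) ∘L ContinuousLinearMap.toSpanSingleton ℝ (Y (φ t x))
      + ContinuousLinearMap.toSpanSingleton ℝ (-Y x)) ∘L (t⁻¹ • .id ℝ ℝ))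
      - ContinuousLinearMap.toSpanSingleton ℝ (vComm X Y x)
      = ContinuousLinearMap.toSpanSingleton ℝ
        (t⁻¹ • (Y (φ t x) - t • A (Y (φ t x)) - Y x) - vComm X Y x) := by
    ext
    simp [sub_eq_add_neg]
  rw [e, ContinuousLinearMap.norm_toSpanSingleton]
  have n1 : ‖t⁻¹ • ContinuousLinearMap.id ℝ ℝ‖ + 1 ≤ 2 * t⁻¹ := by
    rw [norm_smul, norm_inv, Real.norm_eq_abs, abs_of_pos ht0]
    have := (one_le_inv₀ ht0).2 ht1
    have := ContinuousLinearMap.norm_id_le (𝕜 := ℝ) (E := ℝ)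
    nlinarith
  have n2 : (B + 2) * (2 * C * η + t * ‖A‖ ^ 2) * t * (‖t⁻¹ • ContinuousLinearMap.id ℝ ℝ‖ + 1)
      ≤ (B + 2) * (2 * C * η + t * ‖A‖ ^ 2) * t * (2 * t⁻¹) := by gcongr
  have n3 : (B + 2) * (2 * C * η + t * ‖A‖ ^ 2) * t * (2 * t⁻¹)
      = 4 * (B + 2) * C * η + 2 * (B + 2) * ‖A‖ ^ 2 * t := by
    field_simp
    ring
  linarith

end Bracket

section Arcs

open Filter Relation Metric

variable {V : Type*} [NormedAddCommGroup V] [NormedSpace ℝ V]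
variable {ι : Type*} {X : ι → V → V} {W : Set V} {x y : V}

/-- `x` and `y` are joined within `W` by a single arc of an integral curve of some `X i`. -/
def ArcStep (X : ι → V → V) (W : Set V) (x y : V) : Prop :=
  ∃ (i : ι) (c : ℝ) (γ : ℝ → V), γ 0 = x ∧ γ 1 = y ∧ (∀ t ∈ Icc (0 : ℝ) 1, γ t ∈ W) ∧
    ∀ t ∈ Icc (0 : ℝ) 1, HasDerivAt γ (c • X i (γ t)) t

lemma ArcStep.symm (h : ArcStep X W x y) : ArcStep X W y x := by
  obtain ⟨i, c, γ, h0, h1, hW, hd⟩ := h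
  have hI : ∀ t ∈ Icc (0 : ℝ) 1, 1 - t ∈ Icc (0 : ℝ) 1 := fun t ht =>
    ⟨by linarith [ht.2], by linarith [ht.1]⟩
  refine ⟨i, -c, fun t => γ (1 - t), by simpa using h1, by simpa using h0,
    fun t ht => hW _ (hI t ht), fun t ht => ?_⟩
  rw [neg_smul]
  exact (hd _ (hI t ht)).comp_const_sub 1 t

lemma isIntegralArcChain_of_reflTransGen (h : ReflTransGen (ArcStep X W) x y) :
    IsIntegralArcChain X W x y := by
  induction h with
  | refl => exact ⟨0, fun _ => x, rfl, rfl, fun j => j.elim0⟩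
  | @tail b c _ hbc ih =>
    obtain ⟨N, z, h0, hN, hz⟩ := ih
    refine ⟨N + 1, Fin.snoc z c, ?_, Fin.snoc_last _ _, fun j => ?_⟩
    · rw [← Fin.castSucc_zero, Fin.snoc_castSucc, h0]
    · induction j using Fin.lastCases with
      | last =>
        rw [Fin.snoc_castSucc, Fin.succ_last, Fin.snoc_last, hN]
        exact hbc
      | cast j =>
        rw [Fin.snoc_castSucc, Fin.succ_castSucc, Fin.snoc_castSucc]
        exact hz j

lemma IsLocalFlowAt.eventually_arcStep {i : ι} {φ : ℝ → V → V} {K : ℝ}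
    (h : IsLocalFlowAt (X i) φ x K) (hW : W ∈ 𝓝 x) :
    ∀ᶠ q in 𝓝 ((0 : ℝ), x), ArcStep X W q.2 (φ q.1 q.2) := by
  obtain ⟨ρ, hρ, h1⟩ := exists_forall_ball_of_eventually
    (h.flow.and (h.tendsto.eventually_mem hW))
  filter_upwards [prod_mem_nhds (ball_mem_nhds (0 : ℝ) hρ) (ball_mem_nhds x hρ)] with q hq
  obtain ⟨t, y⟩ := q
  obtain ⟨ht, hy⟩ := hq
  have hst : ∀ s ∈ Icc (0 : ℝ) 1, s * t ∈ ball (0 : ℝ) ρ := by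
    intro s hs
    rw [mem_ball_zero_iff] at ht ⊢
    rw [norm_mul, Real.norm_of_nonneg hs.1]
    exact (mul_le_of_le_one_left (norm_nonneg t) hs.2).trans_lt ht
  refine ⟨i, t, fun s => φ (s * t) y, ?_, by simp, fun s hs => (h1 _ (hst s hs) y hy).2,
    fun s hs => ?_⟩
  · simpa using (h1 0 (mem_ball_self hρ) y hy).1.1
  · have := (h1 _ (hst s hs) y hy).1.2.scomp s ((hasDerivAt_id s).mul_const t)
    simpa [Function.comp_def] using this

lemma contDiffOn_vComm {X Y : V → V} {m : ℕ} (hW : IsOpen W)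
    (hX : ContDiffOn ℝ (m + 1 : ℕ) X W) (hY : ContDiffOn ℝ (m + 1 : ℕ) Y W) :
    ContDiffOn ℝ m (vComm X Y) W := by
  have hm : (m : WithTop ℕ∞) + 1 ≤ (m + 1 : ℕ) := by norm_cast
  have hm' : (m : WithTop ℕ∞) ≤ (m + 1 : ℕ) := by norm_cast; omega
  exact ((hY.fderiv_of_isOpen hW hm).clm_apply (hX.of_le hm')).sub
    ((hX.fderiv_of_isOpen hW hm).clm_apply (hY.of_le hm'))

variable {w : ι → ℕ} {r : ℕ}

lemma contDiffOn_iterComm (hW : IsOpen W) (hw : ∀ i, 1 ≤ w i)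
    (hX : ∀ i, ContDiffOn ℝ (r - w i : ℕ) (X i) W) (k : ℕ) (f : Fin (k + 1) → ι)
    (hf : ∑ j, w (f j) ≤ r) : ContDiffOn ℝ (r - ∑ j, w (f j) : ℕ) (iterComm X k f) W := by
  induction k with
  | zero => simpa [iterComm] using hX (f 0)
  | succ k ih =>
    rw [Fin.sum_univ_succ] at hf ⊢
    have h1 : 1 ≤ ∑ j : Fin (k + 1), w (f j.succ) :=
      (hw _).trans (Finset.single_le_sum (f := fun j : Fin (k + 1) => w (f j.succ))
        (fun _ _ => Nat.zero_le _) (Finset.mem_univ 0))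
    have h2 := hw (f 0)
    refine contDiffOn_vComm hW ((hX _).of_le ?_) ((ih _ (by omega)).of_le ?_) <;>
    · norm_cast
      omega

lemma iterComm_mem_steerVel [CompleteSpace V] (hW : IsOpen W) (hw : ∀ i, 1 ≤ w i)
    (hX : ∀ i, ContDiffOn ℝ (r - w i : ℕ) (X i) W) (hX1 : ∀ i, ContDiffOn ℝ 1 (X i) W)
    (k : ℕ) (f : Fin (k + 1) → ι) (hf : ∑ j, w (f j) ≤ r) {z : V} (hz : z ∈ W) :
    iterComm X k f z ∈ steerVel (ArcStep X W) z := by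
  induction k generalizing z with
  | zero =>
    have hc := (hX1 (f 0)).contDiffAt (hW.mem_nhds hz)
    obtain ⟨φ, K, hK, h⟩ := exists_isLocalFlowAt hc
    exact h.mem_steerVel hK hc
      ((h.eventually_arcStep (hW.mem_nhds hz)).mono fun _ => ReflTransGen.single)
  | succ k ih =>
    rw [Fin.sum_univ_succ] at hf
    have h2 := hw (f 0)
    have hY : DifferentiableAt ℝ (iterComm X k fun j => f j.succ) z := by
      refine ((contDiffOn_iterComm hW hw hX k (fun j => f j.succ) (by omega)).contDiffAt
        (hW.mem_nhds hz)).differentiableAt ?_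
      norm_cast
      omega
    have hc := (hX1 (f 0)).contDiffAt (hW.mem_nhds hz)
    obtain ⟨φ, K, hK, h⟩ := exists_isLocalFlowAt hc
    refine h.vComm_mem_steerVel hK hc
      ((h.eventually_arcStep (hW.mem_nhds hz)).mono fun _ => ReflTransGen.single) hY ?_
    filter_upwards [hW.mem_nhds hz] with u hu
    exact ih _ (by omega) hu

lemma steerVel_arcStep_eq_top [CompleteSpace V] (hW : IsOpen W) (hw : ∀ i, 1 ≤ w i)
    (hX : ∀ i, ContDiffOn ℝ (r - w i : ℕ) (X i) W) (hX1 : ∀ i, ContDiffOn ℝ 1 (X i) W)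
    (hH : HormSpan X w r W) {z : V} (hz : z ∈ W) : steerVel (ArcStep X W) z = ⊤ := by
  rw [eq_top_iff, ← hH z hz, Submodule.span_le]
  rintro v ⟨I, hI, rfl⟩
  exact iterComm_mem_steerVel hW hw hX hX1 _ _ hI hz

lemma isIntegralArcChain_of_hormSpan [FiniteDimensional ℝ V] (hW : IsOpen W)
    (hc : IsPreconnected W) (hw : ∀ i, 1 ≤ w i)
    (hX : ∀ i, ContDiffOn ℝ (r - w i : ℕ) (X i) W) (hX1 : ∀ i, ContDiffOn ℝ 1 (X i) W)
    (hH : HormSpan X w r W) (hx : x ∈ W) (hy : y ∈ W) : IsIntegralArcChain X W x y := by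
  have := FiniteDimensional.complete ℝ V
  have : Std.Symm (ArcStep X W) := ⟨fun _ _ => ArcStep.symm⟩
  refine isIntegralArcChain_of_reflTransGen
    (hc.induction₂ (ReflTransGen (ArcStep X W)) (fun z hz => ?_) (fun _ _ _ _ _ _ => .trans)
      (fun _ _ _ _ h => ReflTransGen.stdSymm.symm _ _ h) hx hy)
  exact nhdsWithin_le_nhds (eventually_reflTransGen_of_steerVel_eq_top
    (steerVel_arcStep_eq_top hW hw hX hX1 hH hz))

end Arcs

/-- Chow's theorem for nonsmooth vector fields. Under
Assumptions (C): (1) every `x₀ ∈ Ω` has neighborhoods `U ⊆ W ⊆ Ω` such that any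
two points of `U` are joined, within `W`, by finitely many arcs of integral
curves of the `X_i`'s; (2) since `Ω` is connected, any two points of `Ω` are so
joined within `Ω`. -/
theorem chow_connectivity
    (p n r : ℕ) (hr : 2 ≤ r) (hnp : n < p)
    (Ω : Set (E p)) (hΩo : IsOpen Ω) (hΩconn : IsConnected Ω)
    (hΩb : Bornology.IsBounded Ω)
    (X : Fin (n + 1) → E p → E p)
    (hXreg : ∀ i : Fin n, ContDiffOn ℝ (r - 1 : ℕ) (X i.succ) (closure Ω))
    (hX0reg : ContDiffOn ℝ (r - 2 : ℕ) (X 0) (closure Ω))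
    (hHor : HormSpan X wgt r Ω)
    (hX0C1 : r = 2 → ContDiffOn ℝ 1 (X 0) (closure Ω)) :
    (∀ x₀ ∈ Ω, ∃ U W : Set (E p), IsOpen U ∧ IsOpen W ∧ x₀ ∈ U ∧ U ⊆ W ∧ W ⊆ Ω ∧
      ∀ x ∈ U, ∀ y ∈ U, IsIntegralArcChain X W x y) ∧
    (∀ x ∈ Ω, ∀ y ∈ Ω, IsIntegralArcChain X Ω x y) := by
  have hw : ∀ i : Fin (n + 1), 1 ≤ wgt i := fun i => by unfold wgt; split_ifs <;> norm_num
  have hX : ∀ i, ContDiffOn ℝ (r - wgt i : ℕ) (X i) Ω := by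
    intro i
    cases i using Fin.cases with
    | zero => simpa [wgt] using hX0reg.mono subset_closure
    | succ i => simpa [wgt] using (hXreg i).mono subset_closure
  have hX1 : ∀ i, ContDiffOn ℝ 1 (X i) Ω := by
    intro i
    cases i using Fin.cases with
    | zero =>
      rcases hr.eq_or_lt with h | h
      · exact (hX0C1 h.symm).mono subset_closure
      · exact (hX0reg.mono subset_closure).of_le (by norm_cast; omega)
    | succ i => exact ((hXreg i).mono subset_closure).of_le (by norm_cast; omega)
  have main : ∀ x ∈ Ω, ∀ y ∈ Ω, IsIntegralArcChain X Ω x y := fun x hx y hy =>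
    isIntegralArcChain_of_hormSpan hΩo hΩconn.isPreconnected hw hX hX1 hHor hx hy
  exact ⟨fun x₀ hx₀ => ⟨Ω, Ω, hΩo, hΩo, hx₀, subset_rfl, subset_rfl, main⟩, main⟩

end
end
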